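/- For every simple 𝔤-supermodule M there exist simple 𝔤₀-supermodules V₁, V₂, V₃, V₄ such that M is isomorphic to the socle of K(V₁), to the socle of K'(V₂), to the socle of Coind_{𝔤≥0}^𝔤(V₃), and to the socle of Coind_{𝔤≤0}^𝔤(V₄). -/

import Mathlib

noncomputable section

open Module Function

/-- A complex Lie superalgebra `𝔤 = 𝔤₀̄ ⊕ 𝔤₁̄` equipped with a compatible `ℤ`-grading
`𝔤 = 𝔤₋₁ ⊕ 𝔤₀ ⊕ 𝔤₁`, i.e. `𝔤₀ = 𝔤₀̄`, `𝔤₁̄ = 𝔤₁ ⊕ 𝔤₋₁`, the pieces `𝔤±₁` are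
`𝔤₀̄`-submodules and `[𝔤₁,𝔤₁] = [𝔤₋₁,𝔤₋₁] = 0`.  The super skew-symmetry and the super
Jacobi identity are imposed on (parity-)homogeneous elements, as usual. -/
structure GLSA where
  carrier : Type
  [isACG : AddCommGroup carrier]
  [isMod : Module ℂ carrier]
  bracket : carrier →ₗ[ℂ] carrier →ₗ[ℂ] carrier
  gneg : Submodule ℂ carrier
  g0 : Submodule ℂ carrier
  gpos : Submodule ℂ carrier
  oddCompl : IsCompl g0 (gneg ⊔ gpos)
  disjNP : Disjoint gneg gpos
  br_00 : ∀ x ∈ g0, ∀ y ∈ g0, bracket x y ∈ g0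
  br_0p : ∀ x ∈ g0, ∀ y ∈ gpos, bracket x y ∈ gpos
  br_0n : ∀ x ∈ g0, ∀ y ∈ gneg, bracket x y ∈ gneg
  br_pn : ∀ x ∈ gpos, ∀ y ∈ gneg, bracket x y ∈ g0
  br_pp : ∀ x ∈ gpos, ∀ y ∈ gpos, bracket x y = 0
  br_nn : ∀ x ∈ gneg, ∀ y ∈ gneg, bracket x y = 0
  skew_e : ∀ x ∈ g0, ∀ y, bracket x y = - bracket y x
  skew_oo : ∀ x ∈ gneg ⊔ gpos, ∀ y ∈ gneg ⊔ gpos, bracket x y = bracket y x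
  jacobi_e : ∀ x y z : carrier, (x ∈ g0 ∨ y ∈ g0) →
    bracket x (bracket y z) = bracket (bracket x y) z + bracket y (bracket x z)
  jacobi_oo : ∀ x ∈ gneg ⊔ gpos, ∀ y ∈ gneg ⊔ gpos, ∀ z,
    bracket x (bracket y z) = bracket (bracket x y) z - bracket y (bracket x z)

attribute [instance] GLSA.isACG GLSA.isMod

/-- The odd part `𝔤₁̄ = 𝔤₋₁ ⊕ 𝔤₁` of `L`. -/
def GLSA.odd (L : GLSA) : Submodule ℂ L.carrier := L.gneg ⊔ L.gpos

/-- A `𝔤`-supermodule: a `ℤ₂`-graded complex vector space with a compatible action of the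
Lie superalgebra `L` (signs in the compatibility with the bracket are imposed on
homogeneous elements). -/
structure SMod (L : GLSA) where
  carrier : Type
  [isACG : AddCommGroup carrier]
  [isMod : Module ℂ carrier]
  act : L.carrier →ₗ[ℂ] carrier →ₗ[ℂ] carrier
  ev : Submodule ℂ carrier
  od : Submodule ℂ carrier
  grading : IsCompl ev od
  act_e_ev : ∀ x ∈ L.g0, ∀ m ∈ ev, act x m ∈ ev
  act_e_od : ∀ x ∈ L.g0, ∀ m ∈ od, act x m ∈ od
  act_o_ev : ∀ x ∈ L.odd, ∀ m ∈ ev, act x m ∈ od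
  act_o_od : ∀ x ∈ L.odd, ∀ m ∈ od, act x m ∈ ev
  act_br_e : ∀ x y : L.carrier, (x ∈ L.g0 ∨ y ∈ L.g0) → ∀ m,
    act (L.bracket x y) m = act x (act y m) - act y (act x m)
  act_br_oo : ∀ x ∈ L.odd, ∀ y ∈ L.odd, ∀ m,
    act (L.bracket x y) m = act x (act y m) + act y (act x m)

attribute [instance] SMod.isACG SMod.isMod

/-- A `𝔤₀̄`-supermodule: a `ℤ₂`-graded complex vector space with an action of the (purely
even) Lie algebra `𝔤₀̄ = 𝔤₀` preserving the grading. -/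
structure SMod0 (L : GLSA) where
  carrier : Type
  [isACG : AddCommGroup carrier]
  [isMod : Module ℂ carrier]
  act : ↥L.g0 →ₗ[ℂ] carrier →ₗ[ℂ] carrier
  ev : Submodule ℂ carrier
  od : Submodule ℂ carrier
  grading : IsCompl ev od
  act_ev : ∀ (x : L.g0), ∀ m ∈ ev, act x m ∈ ev
  act_od : ∀ (x : L.g0), ∀ m ∈ od, act x m ∈ od
  act_br : ∀ (x y : L.g0) (m : carrier),
    act ⟨L.bracket ↑x ↑y, L.br_00 ↑x x.2 ↑y y.2⟩ m = act x (act y m) - act y (act x m)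

attribute [instance] SMod0.isACG SMod0.isMod

/-- A homomorphism of `𝔤`-supermodules (homogeneous of degree zero). -/
structure SHom {L : GLSA} (M N : SMod L) where
  toLin : M.carrier →ₗ[ℂ] N.carrier
  map_ev : ∀ m ∈ M.ev, toLin m ∈ N.ev
  map_od : ∀ m ∈ M.od, toLin m ∈ N.od
  equivar : ∀ (x : L.carrier) (m : M.carrier), toLin (M.act x m) = N.act x (toLin m)

/-- Isomorphism of `𝔤`-supermodules. -/
def SIso {L : GLSA} (M N : SMod L) : Prop := ∃ f : SHom M N, Bijective f.toLin

/-- Isomorphism of `𝔤₀̄`-supermodules. -/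
def SIso0 {L : GLSA} (V W : SMod0 L) : Prop :=
  ∃ e : V.carrier ≃ₗ[ℂ] W.carrier,
    (∀ v ∈ V.ev, e v ∈ W.ev) ∧ (∀ v ∈ V.od, e v ∈ W.od) ∧
    (∀ (x : L.g0) (v : V.carrier), e (V.act x v) = W.act x (e v))

/-- Isomorphism of `𝔤`-supermodules up to parity change. -/
def SIsoUpToParity {L : GLSA} (M N : SMod L) : Prop :=
  ∃ e : M.carrier ≃ₗ[ℂ] N.carrier,
    (∀ (x : L.carrier) (m : M.carrier), e (M.act x m) = N.act x (e m)) ∧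
    (((∀ m ∈ M.ev, e m ∈ N.ev) ∧ (∀ m ∈ M.od, e m ∈ N.od)) ∨
     ((∀ m ∈ M.ev, e m ∈ N.od) ∧ (∀ m ∈ M.od, e m ∈ N.ev)))

namespace SMod

variable {L : GLSA}

/-- A (graded) sub-supermodule of a `𝔤`-supermodule. -/
def IsSubmod (M : SMod L) (N : Submodule ℂ M.carrier) : Prop :=
  (∀ (x : L.carrier), ∀ m ∈ N, M.act x m ∈ N) ∧ N ≤ (N ⊓ M.ev) ⊔ (N ⊓ M.od)

/-- A simple sub-supermodule. -/
def IsSimpleSub (M : SMod L) (N : Submodule ℂ M.carrier) : Prop :=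
  M.IsSubmod N ∧ N ≠ ⊥ ∧ ∀ N', M.IsSubmod N' → N' ≤ N → N' = ⊥ ∨ N' = N

/-- The socle: the sum of all simple sub-supermodules. -/
def socle (M : SMod L) : Submodule ℂ M.carrier := sSup {N | M.IsSimpleSub N}

/-- The sub-supermodule generated by a subspace, i.e. `U(𝔤)·S`. -/
def gen (M : SMod L) (S : Submodule ℂ M.carrier) : Submodule ℂ M.carrier :=
  sInf {N | M.IsSubmod N ∧ S ≤ N}

/-- Simplicity of a `𝔤`-supermodule. -/
def IsSimple (M : SMod L) : Prop :=
  (⊤ : Submodule ℂ M.carrier) ≠ ⊥ ∧ ∀ N, M.IsSubmod N → N = ⊥ ∨ N = ⊤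

/-- Indecomposability of a `𝔤`-supermodule. -/
def Indecomposable (M : SMod L) : Prop :=
  (⊤ : Submodule ℂ M.carrier) ≠ ⊥ ∧
  ∀ N₁ N₂, M.IsSubmod N₁ → M.IsSubmod N₂ → N₁ ⊓ N₂ = ⊥ → N₁ ⊔ N₂ = ⊤ →
    N₁ = ⊥ ∨ N₂ = ⊥

/-- The parity change functor `Π`. -/
def pshift (M : SMod L) : SMod L where
  carrier := M.carrier
  act := M.act
  ev := M.od
  od := M.ev
  grading := M.grading.symm
  act_e_ev := M.act_e_od
  act_e_od := M.act_e_ev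
  act_o_ev := M.act_o_od
  act_o_od := M.act_o_ev
  act_br_e := M.act_br_e
  act_br_oo := M.act_br_oo

/-- The space `M^{𝔤₁}` of `𝔤₁`-invariants. -/
def invPos (M : SMod L) : Submodule ℂ M.carrier where
  carrier := {m | ∀ x ∈ L.gpos, M.act x m = 0}
  add_mem' := by
    intro a b ha hb x hx
    rw [map_add, ha x hx, hb x hx, add_zero]
  zero_mem' := by intro x hx; simp
  smul_mem' := by
    intro c a ha x hx
    rw [map_smul, ha x hx, smul_zero]

/-- The space `M^{𝔤₋₁}` of `𝔤₋₁`-invariants. -/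
def invNeg (M : SMod L) : Submodule ℂ M.carrier where
  carrier := {m | ∀ x ∈ L.gneg, M.act x m = 0}
  add_mem' := by
    intro a b ha hb x hx
    rw [map_add, ha x hx, hb x hx, add_zero]
  zero_mem' := by intro x hx; simp
  smul_mem' := by
    intro c a ha x hx
    rw [map_smul, ha x hx, smul_zero]

/-- Iterated action of a list of elements of `𝔤`. -/
def actList (M : SMod L) : List L.carrier → M.carrier → M.carrier
  | [], m => m
  | x :: xs, m => M.act x (M.actList xs m)

end SMod

namespace SMod0

variable {L : GLSA}

/-- A (graded) sub-supermodule of a `𝔤₀̄`-supermodule. -/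
def IsSubmod (V : SMod0 L) (N : Submodule ℂ V.carrier) : Prop :=
  (∀ (x : L.g0), ∀ v ∈ N, V.act x v ∈ N) ∧ N ≤ (N ⊓ V.ev) ⊔ (N ⊓ V.od)

/-- Simplicity of a `𝔤₀̄`-supermodule. -/
def IsSimple (V : SMod0 L) : Prop :=
  (⊤ : Submodule ℂ V.carrier) ≠ ⊥ ∧ ∀ N, V.IsSubmod N → N = ⊥ ∨ N = ⊤

end SMod0

/-- `IsKac V K η` expresses that `K`, together with the (even, `𝔤₀̄`-equivariant) unit map
`η : V → K` whose image is annihilated by `𝔤₁`, is *the* Kac module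
`K(V) = Ind_{𝔤≥0}^{𝔤} V` of the `𝔤₀̄`-supermodule `V` (on which `𝔤₁` acts by zero), i.e.
satisfies the universal property `Hom_𝔤(K(V), M) = Hom_{𝔤₀̄}(V, M^{𝔤₁})`. -/
structure IsKac {L : GLSA} (V : SMod0 L) (K : SMod L) (η : V.carrier →ₗ[ℂ] K.carrier) : Prop where
  map_ev : ∀ v ∈ V.ev, η v ∈ K.ev
  map_od : ∀ v ∈ V.od, η v ∈ K.od
  equivar : ∀ (x : L.g0) (v : V.carrier), η (V.act x v) = K.act ↑x (η v)
  pos_zero : ∀ x ∈ L.gpos, ∀ v : V.carrier, K.act x (η v) = 0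
  injective : Injective η
  generates : K.gen (LinearMap.range η) = ⊤
  universal : ∀ (M : SMod L) (φ : V.carrier →ₗ[ℂ] M.carrier),
    (∀ v ∈ V.ev, φ v ∈ M.ev) → (∀ v ∈ V.od, φ v ∈ M.od) →
    (∀ (x : L.g0) (v : V.carrier), φ (V.act x v) = M.act ↑x (φ v)) →
    (∀ x ∈ L.gpos, ∀ v : V.carrier, M.act x (φ v) = 0) →
    ∃! Φ : SHom K M, ∀ v, Φ.toLin (η v) = φ v

/-- The opposite Kac module `K'(V) = Ind_{𝔤≤0}^{𝔤} V` (with `𝔤₋₁` acting by zero on `V`),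
described by its universal property. -/
structure IsKac' {L : GLSA} (V : SMod0 L) (K : SMod L) (η : V.carrier →ₗ[ℂ] K.carrier) : Prop where
  map_ev : ∀ v ∈ V.ev, η v ∈ K.ev
  map_od : ∀ v ∈ V.od, η v ∈ K.od
  equivar : ∀ (x : L.g0) (v : V.carrier), η (V.act x v) = K.act ↑x (η v)
  neg_zero : ∀ x ∈ L.gneg, ∀ v : V.carrier, K.act x (η v) = 0
  injective : Injective η
  generates : K.gen (LinearMap.range η) = ⊤
  universal : ∀ (M : SMod L) (φ : V.carrier →ₗ[ℂ] M.carrier),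
    (∀ v ∈ V.ev, φ v ∈ M.ev) → (∀ v ∈ V.od, φ v ∈ M.od) →
    (∀ (x : L.g0) (v : V.carrier), φ (V.act x v) = M.act ↑x (φ v)) →
    (∀ x ∈ L.gneg, ∀ v : V.carrier, M.act x (φ v) = 0) →
    ∃! Φ : SHom K M, ∀ v, Φ.toLin (η v) = φ v

/-- `IsCoindPos W C ε` expresses that `C`, together with the (even, `𝔤₀̄`-equivariant)
counit `ε : C → W` killing `𝔤₁·C`, is the coinduced module `Coind_{𝔤≥0}^{𝔤}(W)` of the
`𝔤₀̄`-supermodule `W` (with `𝔤₁` acting by zero), i.e. satisfies the universal property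
`Hom_𝔤(M, Coind(W)) = Hom_{𝔤≥0}(Res M, W)`. -/
structure IsCoindPos {L : GLSA} (W : SMod0 L) (C : SMod L) (ε : C.carrier →ₗ[ℂ] W.carrier) : Prop where
  map_ev : ∀ c ∈ C.ev, ε c ∈ W.ev
  map_od : ∀ c ∈ C.od, ε c ∈ W.od
  equivar : ∀ (x : L.g0) (c : C.carrier), ε (C.act ↑x c) = W.act x (ε c)
  pos_zero : ∀ x ∈ L.gpos, ∀ c : C.carrier, ε (C.act x c) = 0
  universal : ∀ (M : SMod L) (ψ : M.carrier →ₗ[ℂ] W.carrier),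
    (∀ m ∈ M.ev, ψ m ∈ W.ev) → (∀ m ∈ M.od, ψ m ∈ W.od) →
    (∀ (x : L.g0) (m : M.carrier), ψ (M.act ↑x m) = W.act x (ψ m)) →
    (∀ x ∈ L.gpos, ∀ m : M.carrier, ψ (M.act x m) = 0) →
    ∃! Φ : SHom M C, ∀ m, ε (Φ.toLin m) = ψ m

/-- `Coind_{𝔤≤0}^{𝔤}(W)`, by its universal property. -/
structure IsCoindNeg {L : GLSA} (W : SMod0 L) (C : SMod L) (ε : C.carrier →ₗ[ℂ] W.carrier) : Prop where
  map_ev : ∀ c ∈ C.ev, ε c ∈ W.ev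
  map_od : ∀ c ∈ C.od, ε c ∈ W.od
  equivar : ∀ (x : L.g0) (c : C.carrier), ε (C.act ↑x c) = W.act x (ε c)
  neg_zero : ∀ x ∈ L.gneg, ∀ c : C.carrier, ε (C.act x c) = 0
  universal : ∀ (M : SMod L) (ψ : M.carrier →ₗ[ℂ] W.carrier),
    (∀ m ∈ M.ev, ψ m ∈ W.ev) → (∀ m ∈ M.od, ψ m ∈ W.od) →
    (∀ (x : L.g0) (m : M.carrier), ψ (M.act ↑x m) = W.act x (ψ m)) →
    (∀ x ∈ L.gneg, ∀ m : M.carrier, ψ (M.act x m) = 0) →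
    ∃! Φ : SHom M C, ∀ m, ε (Φ.toLin m) = ψ m

/-- The subspace `Λ^max(𝔤₋₁) ⊗ V ⊆ K(V)`: the span of all elements obtained by acting on
`η(V)` with `dim 𝔤₋₁` many elements of `𝔤₋₁`. -/
def botPartNeg {L : GLSA} (V : SMod0 L) (K : SMod L) (η : V.carrier →ₗ[ℂ] K.carrier) :
    Submodule ℂ K.carrier :=
  Submodule.span ℂ {m | ∃ (xs : List L.carrier) (v : V.carrier),
    xs.length = finrank ℂ ↥L.gneg ∧ (∀ x ∈ xs, x ∈ L.gneg) ∧ m = K.actList xs (η v)}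

/-- The subspace `Λ^max(𝔤₁) ⊗ V ⊆ K'(V)`. -/
def botPartPos {L : GLSA} (V : SMod0 L) (K : SMod L) (η : V.carrier →ₗ[ℂ] K.carrier) :
    Submodule ℂ K.carrier :=
  Submodule.span ℂ {m | ∃ (xs : List L.carrier) (v : V.carrier),
    xs.length = finrank ℂ ↥L.gpos ∧ (∀ x ∈ xs, x ∈ L.gpos) ∧ m = K.actList xs (η v)}

/-- For `x ∈ 𝔤₀̄`, the operator `ad x` restricted to `𝔤₁`. -/
def adPos (L : GLSA) (x : L.g0) : ↥L.gpos →ₗ[ℂ] ↥L.gpos :=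
  (L.bracket ↑x).restrict (fun y hy => L.br_0p ↑x x.2 y hy)

/-- For `x ∈ 𝔤₀̄`, the operator `ad x` restricted to `𝔤₋₁`. -/
def adNeg (L : GLSA) (x : L.g0) : ↥L.gneg →ₗ[ℂ] ↥L.gneg :=
  (L.bracket ↑x).restrict (fun y hy => L.br_0n ↑x x.2 y hy)

/-- The character by which `𝔤₀̄` acts on the one-dimensional module `Λ^max(𝔤₁)`. -/
def traceCharPos (L : GLSA) (x : L.g0) : ℂ := LinearMap.trace ℂ ↥L.gpos (adPos L x)

/-- The character by which `𝔤₀̄` acts on the one-dimensional module `Λ^max(𝔤₋₁)`. -/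
def traceCharNeg (L : GLSA) (x : L.g0) : ℂ := LinearMap.trace ℂ ↥L.gneg (adNeg L x)

/-- `IsTwistBy V W χ swap` expresses that `W ≅ ℂ_χ ⊗ V` as `𝔤₀̄`-supermodules, where `ℂ_χ`
is the one-dimensional module with character `χ`, of odd parity iff `swap = true`.
Taking `χ` to be `traceCharPos`/`traceCharNeg` (resp. their negatives) and `swap` the parity
of `dim 𝔤±₁` expresses `W ≅ Λ^max(𝔤±₁) ⊗ V` (resp. `W ≅ Λ^max(𝔤±₁^*) ⊗ V`). -/
def IsTwistBy {L : GLSA} (V W : SMod0 L) (χ : ↥L.g0 → ℂ) (swap : Bool) : Prop :=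
  ∃ e : V.carrier ≃ₗ[ℂ] W.carrier,
    (∀ (x : L.g0) (v : V.carrier), W.act x (e v) = e (V.act x v) + χ x • e v) ∧
    (if swap then (∀ v ∈ V.ev, e v ∈ W.od) ∧ (∀ v ∈ V.od, e v ∈ W.ev)
     else (∀ v ∈ V.ev, e v ∈ W.ev) ∧ (∀ v ∈ V.od, e v ∈ W.od))

/-- Parity (as a `Bool`) of `dim 𝔤₁`. -/
def parPos (L : GLSA) : Bool := (finrank ℂ ↥L.gpos) % 2 == 1

/-- Parity (as a `Bool`) of `dim 𝔤₋₁`. -/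
def parNeg (L : GLSA) : Bool := (finrank ℂ ↥L.gneg) % 2 == 1

section ExteriorAlgebraAux

open ExteriorAlgebra

variable {k N : Type*} [Field k] [AddCommGroup N] [Module k N]

theorem ExteriorAlgebra.left_induction' {P : ExteriorAlgebra k N → Prop} (one : P 1)
    (add : ∀ x y, P x → P y → P (x + y)) (smul : ∀ (c : k) x, P x → P (c • x))
    (ι_mul : ∀ y x, P x → P (ι k y * x)) (a : ExteriorAlgebra k N) : P a := by
  refine CliffordAlgebra.left_induction (Q := (0 : QuadraticForm k N)) (P := P) ?_ add
    (fun x m h => ι_mul m x h) a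
  intro r
  rw [Algebra.algebraMap_eq_smul_one]
  exact smul r 1 one

theorem ExteriorAlgebra.right_induction' {P : ExteriorAlgebra k N → Prop} (one : P 1)
    (add : ∀ x y, P x → P y → P (x + y)) (smul : ∀ (c : k) x, P x → P (c • x))
    (mul_ι : ∀ y x, P x → P (x * ι k y)) (a : ExteriorAlgebra k N) : P a := by
  refine CliffordAlgebra.right_induction (Q := (0 : QuadraticForm k N)) (P := P) ?_ add
    (fun m x h => mul_ι m x h) a
  intro r
  rw [Algebra.algebraMap_eq_smul_one]
  exact smul r 1 one

instance ExteriorAlgebra.finite_of_finiteDimensional [FiniteDimensional k N] :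
    Module.Finite k (ExteriorAlgebra k N) :=
  Module.Finite.of_basis (Module.finBasis k N).ExteriorAlgebra

theorem ExteriorAlgebra.exteriorPower_eq_bot [FiniteDimensional k N] {m : ℕ}
    (hm : finrank k N < m) : ⋀[k]^m N = ⊥ := by
  rw [← ιMulti_span_fixedDegree, Submodule.span_eq_bot]
  rintro _ ⟨v, rfl⟩
  refine AlternatingMap.map_linearDependent _ v fun h => ?_
  have := h.fintype_card_le_finrank
  simp at this
  omega

theorem ExteriorAlgebra.ι_mul_mem_exteriorPower {m : ℕ} (y : N) {a : ExteriorAlgebra k N}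
    (ha : a ∈ ⋀[k]^m N) : ι k y * a ∈ ⋀[k]^(m + 1) N := by
  rw [exteriorPower, pow_succ']
  exact Submodule.mul_mem_mul ⟨y, rfl⟩ ha

theorem ExteriorAlgebra.mul_ι_mem_exteriorPower {m : ℕ} (y : N) {a : ExteriorAlgebra k N}
    (ha : a ∈ ⋀[k]^m N) : a * ι k y ∈ ⋀[k]^(m + 1) N := by
  rw [exteriorPower, pow_succ]
  exact Submodule.mul_mem_mul ha ⟨y, rfl⟩

/-- A linear map on the exterior algebra which does not kill `1` does not kill some element all of
whose left multiples by vectors it kills. -/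
theorem ExteriorAlgebra.exists_ne_zero_ι_mul_eq_zero [FiniteDimensional k N] {Z : Type*}
    [AddCommGroup Z] [Module k Z] (f : ExteriorAlgebra k N →ₗ[k] Z) (h1 : f 1 ≠ 0) :
    ∃ a, f a ≠ 0 ∧ ∀ y, f (ι k y * a) = 0 := by
  classical
  by_contra! hcon
  have key : ∀ m, ∃ a ∈ ⋀[k]^m N, f a ≠ 0 := by
    intro m
    induction m with
    | zero => exact ⟨1, by simp [exteriorPower], h1⟩
    | succ m ih =>
      obtain ⟨a, ha, hfa⟩ := ih
      obtain ⟨y, hy⟩ := hcon a hfa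
      exact ⟨_, ι_mul_mem_exteriorPower y ha, hy⟩
  obtain ⟨a, ha, hfa⟩ := key (finrank k N + 1)
  rw [exteriorPower_eq_bot (Nat.lt_succ_self _), Submodule.mem_bot] at ha
  exact hfa (by rw [ha, map_zero])

/-- The product of the vectors of a basis. -/
def ExteriorAlgebra.top {n : ℕ} (b : Basis (Fin n) k N) : ExteriorAlgebra k N := ιMulti k n b

/-- The coefficient of an element of the exterior algebra at `ExteriorAlgebra.top b`. -/
def ExteriorAlgebra.topCoeff {n : ℕ} (b : Basis (Fin n) k N) : ExteriorAlgebra k N →ₗ[k] k :=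
  liftAlternating fun i => if h : i = n then h ▸ b.det else 0

section TopCoeff

variable {n : ℕ} (b : Basis (Fin n) k N)

theorem ExteriorAlgebra.topCoeff_ιMulti (v : Fin n → N) :
    topCoeff b (ιMulti k n v) = b.det v := by
  simp [topCoeff, liftAlternating_apply_ιMulti]

theorem ExteriorAlgebra.topCoeff_top : topCoeff b (top b) = 1 := by
  rw [top, topCoeff_ιMulti, b.det_self]

theorem ExteriorAlgebra.topCoeff_eq_zero {m : ℕ} (hm : m ≠ n) {a : ExteriorAlgebra k N}
    (ha : a ∈ ⋀[k]^m N) : topCoeff b a = 0 := by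
  rw [← ιMulti_span_fixedDegree] at ha
  refine (Submodule.span_le (p := LinearMap.ker (topCoeff b))).2 ?_ ha
  rintro _ ⟨v, rfl⟩
  simp [topCoeff, liftAlternating_apply_ιMulti, hm]

/-- An endomorphism preserving degrees acts on the top degree by a scalar. -/
theorem ExteriorAlgebra.topCoeff_apply (D : ExteriorAlgebra k N →ₗ[k] ExteriorAlgebra k N)
    (hD : ∀ m, ∀ a ∈ ⋀[k]^m N, D a ∈ ⋀[k]^m N) (a : ExteriorAlgebra k N) :
    topCoeff b (D a) = topCoeff b (D (top b)) * topCoeff b a := by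
  suffices h : topCoeff b ∘ₗ D = topCoeff b (D (top b)) • topCoeff b from LinearMap.congr_fun h a
  refine lhom_ext fun m => ?_
  ext v
  have hv : ιMulti k m v ∈ ⋀[k]^m N := ιMulti_range k m ⟨v, rfl⟩
  by_cases hm : m = n
  · subst hm
    have := ((topCoeff b ∘ₗ D).compAlternatingMap (ιMulti k m)).eq_smul_basis_det b
    simpa [topCoeff_ιMulti, top] using congrArg (fun f => f v) this
  · simp [topCoeff_eq_zero b hm hv, topCoeff_eq_zero b hm (hD m _ hv)]

theorem ExteriorAlgebra.exists_eq_prod_mul (l : List (Fin n)) (hl : l.Nodup)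
    (z : ExteriorAlgebra k N) (hz : ∀ i ∈ l, ι k (b i) * z = 0) :
    ∃ w, z = (l.map fun i => ι k (b i)).prod * w := by
  induction l generalizing z with
  | nil => exact ⟨z, by simp⟩
  | cons i l ih =>
    rw [List.nodup_cons] at hl
    have hc : ∀ (y : N) (a : ExteriorAlgebra k N),
        CliffordAlgebra.contractLeft (Q := (0 : QuadraticForm k N)) (b.coord i) (ι k y * a) =
          b.coord i y • a -
            ι k y * CliffordAlgebra.contractLeft (Q := (0 : QuadraticForm k N)) (b.coord i) a :=
      fun y a => CliffordAlgebra.contractLeft_ι_mul _ _ _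
    obtain ⟨w, hw⟩ := ih hl.2
      (CliffordAlgebra.contractLeft (Q := (0 : QuadraticForm k N)) (b.coord i) z) (by
        intro j hj
        have h := hc (b j) z
        rw [hz j (List.mem_cons_of_mem _ hj), map_zero] at h
        have hij : j ≠ i := fun h => hl.1 (h ▸ hj)
        simpa [hij] using h)
    refine ⟨w, ?_⟩
    have h := hc (b i) z
    rw [hz i List.mem_cons_self, map_zero, hw] at h
    simp only [Basis.coord_apply, Basis.repr_self, Finsupp.single_eq_same, one_smul] at h
    rw [List.map_cons, List.prod_cons, mul_assoc]
    exact sub_eq_zero.1 h.symm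

theorem ExteriorAlgebra.top_mem : top b ∈ ⋀[k]^n N := ιMulti_range k n ⟨b, rfl⟩

theorem ExteriorAlgebra.top_mul_ι (y : N) : top b * ι k y = 0 := by
  have := Module.Finite.of_basis b
  have h := mul_ι_mem_exteriorPower y (top_mem b)
  rwa [exteriorPower_eq_bot (by rw [finrank_eq_card_basis b]; simp), Submodule.mem_bot] at h

/-- The elements of the exterior algebra killed by all vectors are of top degree. -/
theorem ExteriorAlgebra.eq_smul_top (z : ExteriorAlgebra k N) (hz : ∀ y, ι k y * z = 0) :
    ∃ c : k, z = c • top b := by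
  obtain ⟨w, rfl⟩ := exists_eq_prod_mul b (List.finRange n) (List.nodup_finRange n) z
    fun i _ => hz (b i)
  have ht : ((List.finRange n).map fun i => ι k (b i)).prod = top b := by
    rw [top, ιMulti_apply, List.ofFn_eq_map]
  rw [ht]
  clear ht hz
  induction w using ExteriorAlgebra.left_induction' with
  | one => exact ⟨1, by simp⟩
  | add x y hx hy =>
    obtain ⟨c, hc⟩ := hx
    obtain ⟨d, hd⟩ := hy
    exact ⟨c + d, by rw [mul_add, hc, hd, add_smul]⟩
  | smul c x hx =>
    obtain ⟨d, hd⟩ := hx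
    exact ⟨c * d, by rw [mul_smul_comm, hd, mul_smul]⟩
  | ι_mul y x _ => exact ⟨0, by rw [← mul_assoc, top_mul_ι, zero_mul, zero_smul]⟩

/-- The exterior algebra of a finite-dimensional space is a Frobenius algebra. -/
theorem ExteriorAlgebra.exists_topCoeff_mul_ne_zero {a : ExteriorAlgebra k N} (ha : a ≠ 0) :
    ∃ w, topCoeff b (w * a) ≠ 0 := by
  have := Module.Finite.of_basis b
  obtain ⟨w, hw, hy⟩ := exists_ne_zero_ι_mul_eq_zero (LinearMap.mulRight k a) (by simpa using ha)
  obtain ⟨c, hc⟩ := eq_smul_top b (w * a) fun y => by simpa [mul_assoc] using hy y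
  refine ⟨w, ?_⟩
  rw [hc, map_smul, topCoeff_top]
  rintro h
  apply hw
  simp_all

end TopCoeff

section TwistedDerivation

variable {Z : Type*} [AddCommGroup Z] [Module k Z]

/-- Operators satisfying a twisted Leibniz rule with respect to an action of the exterior algebra
are determined by arbitrary "commutators" `B` subject to the obvious compatibility condition. -/
theorem ExteriorAlgebra.exists_twistedDerivation (ρ : ExteriorAlgebra k N →ₐ[k] Module.End k Z)
    (B : N →ₗ[k] Module.End k Z) (s : k)
    (hB : ∀ y z, B y (ρ (ι k y) z) + s • ρ (ι k y) (B y z) = 0) :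
    ∃ R : ExteriorAlgebra k N →ₗ[k] Module.End k Z, R 1 = 0 ∧
      ∀ y a z, R (ι k y * a) z = B y (ρ a z) + s • ρ (ι k y) (R a z) := by
  let S : N →ₗ[k] Module.End k (Z × Z) :=
    { toFun := fun y => LinearMap.prod (ρ (ι k y) ∘ₗ LinearMap.fst k Z Z)
        (B y ∘ₗ LinearMap.fst k Z Z + s • (ρ (ι k y) ∘ₗ LinearMap.snd k Z Z))
      map_add' := by
        intro x y
        ext z <;> simp
      map_smul' := by
        intro c x
        ext z <;> simp [smul_comm s c] }
  have hρ : ∀ y z, ρ (ι k y) (ρ (ι k y) z) = 0 := by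
    intro y z
    rw [← Module.End.mul_apply, ← map_mul, ι_sq_zero, map_zero, LinearMap.zero_apply]
  have hS : ∀ y, S y * S y = 0 := by
    intro y
    ext z <;> simp [S, hρ, hB]
  let σ := lift k ⟨S, hS⟩
  have hσ1 : ∀ a p, (σ a p).1 = ρ a p.1 := by
    intro a
    induction a using ExteriorAlgebra.left_induction' with
    | one => simp
    | add x y hx hy => simp [hx, hy]
    | smul c x hx => simp [hx]
    | ι_mul y x hx => intro p; simp [σ, S, ← hx]
  refine ⟨{ toFun := fun a => LinearMap.snd k Z Z ∘ₗ σ a ∘ₗ LinearMap.inl k Z Z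
            map_add' := fun a b => by ext z; simp
            map_smul' := fun c a => by ext z; simp }, by ext z; simp, fun y a z => ?_⟩
  simp [← hσ1 a (z, 0), σ, S]

/-- The derivation of the exterior algebra extending an endomorphism. -/
theorem ExteriorAlgebra.exists_derivation (e : N →ₗ[k] N) :
    ∃ D : ExteriorAlgebra k N →ₗ[k] ExteriorAlgebra k N, D 1 = 0 ∧
      ∀ y a, D (ι k y * a) = ι k (e y) * a + ι k y * D a := by
  obtain ⟨R, h1, h2⟩ := exists_twistedDerivation (N := N) (Algebra.lmul k (ExteriorAlgebra k N))
    ((Algebra.lmul k (ExteriorAlgebra k N)).toLinearMap ∘ₗ ι k ∘ₗ e) 1 (by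
      intro y z
      simp [← mul_assoc, ← add_mul, ι_add_mul_swap])
  refine ⟨R.flip 1, by simp [h1], fun y a => ?_⟩
  simp [h2]

/-- The derivation of the exterior algebra extending an endomorphism. -/
def ExteriorAlgebra.derivation (e : N →ₗ[k] N) : ExteriorAlgebra k N →ₗ[k] ExteriorAlgebra k N :=
  (exists_derivation e).choose

theorem ExteriorAlgebra.derivation_one (e : N →ₗ[k] N) : derivation e 1 = 0 :=
  (exists_derivation e).choose_spec.1

theorem ExteriorAlgebra.derivation_ι_mul (e : N →ₗ[k] N) (y : N) (a : ExteriorAlgebra k N) :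
    derivation e (ι k y * a) = ι k (e y) * a + ι k y * derivation e a :=
  (exists_derivation e).choose_spec.2 y a

theorem ExteriorAlgebra.derivation_mem (e : N →ₗ[k] N) (m : ℕ) (a : ExteriorAlgebra k N)
    (ha : a ∈ ⋀[k]^m N) : derivation e a ∈ ⋀[k]^m N := by
  induction ha using Submodule.pow_induction_on_left' with
  | algebraMap r =>
    rw [Algebra.algebraMap_eq_smul_one, map_smul, derivation_one, smul_zero]
    exact zero_mem _
  | add x y i hx hy ihx ihy => rw [map_add]; exact add_mem ihx ihy
  | mem_mul m hm i x hx ih =>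
    obtain ⟨y, rfl⟩ := hm
    rw [derivation_ι_mul]
    exact add_mem (ι_mul_mem_exteriorPower _ hx) (ι_mul_mem_exteriorPower _ ih)

theorem ExteriorAlgebra.derivation_add (e f : N →ₗ[k] N) :
    derivation (e + f) = derivation e + derivation f := by
  refine LinearMap.ext fun a => ?_
  induction a using ExteriorAlgebra.left_induction' with
  | one => simp [derivation_one]
  | add x y hx hy => simp only [map_add, hx, hy]
  | smul c x hx => simp only [map_smul, hx]
  | ι_mul y x hx =>
    simp only [LinearMap.add_apply] at hx ⊢
    simp only [derivation_ι_mul, hx, LinearMap.add_apply, map_add]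
    noncomm_ring

theorem ExteriorAlgebra.derivation_smul (c : k) (e : N →ₗ[k] N) :
    derivation (c • e) = c • derivation e := by
  refine LinearMap.ext fun a => ?_
  induction a using ExteriorAlgebra.left_induction' with
  | one => simp [derivation_one]
  | add x y hx hy => simp only [map_add, hx, hy]
  | smul c x hx => simp only [map_smul, hx]
  | ι_mul y x hx =>
    simp only [LinearMap.smul_apply] at hx ⊢
    simp [derivation_ι_mul, hx]

theorem ExteriorAlgebra.derivation_lie (e f : N →ₗ[k] N) (a : ExteriorAlgebra k N) :
    derivation (e ∘ₗ f - f ∘ₗ e) a =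
      derivation e (derivation f a) - derivation f (derivation e a) := by
  induction a using ExteriorAlgebra.left_induction' with
  | one => simp [derivation_one]
  | add x y hx hy => simp only [map_add, hx, hy]; abel
  | smul c x hx => simp only [map_smul, hx, smul_sub]
  | ι_mul y x hx =>
    simp only [derivation_ι_mul, hx, LinearMap.sub_apply, map_sub, map_add, LinearMap.comp_apply]
    noncomm_ring

end TwistedDerivation

section Induced

open TensorProduct

variable {V : Type*} [AddCommGroup V] [Module k V]

theorem ExteriorAlgebra.tensor_induction {P : ExteriorAlgebra k N ⊗[k] V → Prop}
    (one : ∀ v, P (1 ⊗ₜ v)) (add : ∀ x y, P x → P y → P (x + y))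
    (ι_mul : ∀ y x, P x → P ((LinearMap.mulLeft k (ι k y)).rTensor V x))
    (z : ExteriorAlgebra k N ⊗[k] V) : P z := by
  induction z with
  | zero => simpa using one 0
  | add x y hx hy => exact add x y hx hy
  | tmul a v =>
    induction a using ExteriorAlgebra.left_induction' generalizing v with
    | one => exact one v
    | add x y hx hy => rw [add_tmul]; exact add _ _ (hx v) (hy v)
    | smul c x hx => rw [smul_tmul]; exact hx _
    | ι_mul y x hx => exact ι_mul y _ (hx v)

/-- The action of the exterior algebra on `Λ(N) ⊗ V` by left multiplication. -/
def ExteriorAlgebra.leftAct (V : Type*) [AddCommGroup V] [Module k V] :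
    ExteriorAlgebra k N →ₐ[k] Module.End k (ExteriorAlgebra k N ⊗[k] V) :=
  (Module.End.rTensorAlgHom k (ExteriorAlgebra k N) V).comp (Algebra.lmul k (ExteriorAlgebra k N))

@[simp]
theorem ExteriorAlgebra.leftAct_tmul (a b : ExteriorAlgebra k N) (v : V) :
    leftAct V a (b ⊗ₜ v) = (a * b) ⊗ₜ v := rfl

theorem ExteriorAlgebra.exists_antiderivation
    (B : N →ₗ[k] Module.End k (ExteriorAlgebra k N ⊗[k] V))
    (hB : ∀ y z, B y (leftAct V (ι k y) z) = leftAct V (ι k y) (B y z)) :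
    ∃ T : Module.End k (ExteriorAlgebra k N ⊗[k] V), (∀ v, T (1 ⊗ₜ v) = 0) ∧
      ∀ y z, T (leftAct V (ι k y) z) = B y z - leftAct V (ι k y) (T z) := by
  obtain ⟨R, h1, h2⟩ := exists_twistedDerivation (leftAct V) B (-1) (by
    intro y z
    rw [hB, neg_one_smul, add_neg_cancel])
  refine ⟨TensorProduct.lift
    (LinearMap.compl₂ R (TensorProduct.mk k (ExteriorAlgebra k N) V 1)), ?_, ?_⟩
  · intro v
    simp [h1]
  · intro y z
    induction z with
    | zero => simp
    | add x y hx hy => simp only [map_add, hx, hy]; abel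
    | tmul a v => simp [h2, sub_eq_add_neg]

end Induced

end ExteriorAlgebraAux

section Parity

variable {V V' : Type*} [AddCommGroup V] [Module ℂ V] [AddCommGroup V'] [Module ℂ V']

/-- The parity involution of a `ℤ/2`-graded vector space. -/
def parity (E O : Submodule ℂ V) (h : IsCompl E O) : V →ₗ[ℂ] V :=
  E.projection O h - O.projection E h.symm

variable {E O : Submodule ℂ V} (h : IsCompl E O) {E' O' : Submodule ℂ V'} (h' : IsCompl E' O')

theorem eq_zero_of_neg_eq_self {v : V} (hv : -v = v) : v = 0 := by
  have h2 : v = (1 / 2 : ℂ) • (v - -v) := by module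
  rwa [hv, sub_self, smul_zero] at h2

theorem parity_of_mem_even {v : V} (hv : v ∈ E) : parity E O h v = v := by
  rw [parity, LinearMap.sub_apply, Submodule.projection_apply_of_mem_left h hv,
    (Submodule.projection_apply_eq_zero_iff h.symm).2 hv, sub_zero]

theorem parity_of_mem_odd {v : V} (hv : v ∈ O) : parity E O h v = -v := by
  rw [parity, LinearMap.sub_apply, Submodule.projection_apply_of_mem_left h.symm hv,
    (Submodule.projection_apply_eq_zero_iff h).2 hv, zero_sub]

include h in
theorem exists_even_add_odd (v : V) : ∃ e ∈ E, ∃ o ∈ O, v = e + o := by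
  obtain ⟨e, he, o, ho, rfl⟩ := Submodule.mem_sup.1 (h.sup_eq_top ▸ Submodule.mem_top : v ∈ E ⊔ O)
  exact ⟨e, he, o, ho, rfl⟩

theorem parity_parity (v : V) : parity E O h (parity E O h v) = v := by
  obtain ⟨e, he, o, ho, rfl⟩ := exists_even_add_odd h v
  simp [parity_of_mem_even h he, parity_of_mem_odd h ho]

theorem mem_even_iff {v : V} : v ∈ E ↔ parity E O h v = v := by
  refine ⟨parity_of_mem_even h, fun hv => ?_⟩
  obtain ⟨e, he, o, ho, rfl⟩ := exists_even_add_odd h v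
  rw [map_add, parity_of_mem_even h he, parity_of_mem_odd h ho, add_right_inj] at hv
  rw [eq_zero_of_neg_eq_self hv, add_zero]
  exact he

theorem mem_odd_iff {v : V} : v ∈ O ↔ parity E O h v = -v := by
  refine ⟨parity_of_mem_odd h, fun hv => ?_⟩
  obtain ⟨e, he, o, ho, rfl⟩ := exists_even_add_odd h v
  rw [map_add, parity_of_mem_even h he, parity_of_mem_odd h ho, neg_add, add_left_inj] at hv
  rw [eq_zero_of_neg_eq_self hv.symm, zero_add]
  exact ho

theorem le_sup_inf_iff_parity (N : Submodule ℂ V) :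
    N ≤ (N ⊓ E) ⊔ (N ⊓ O) ↔ ∀ v ∈ N, parity E O h v ∈ N := by
  constructor
  · intro hN v hv
    obtain ⟨e, he, o, ho, rfl⟩ := Submodule.mem_sup.1 (hN hv)
    rw [map_add, parity_of_mem_even h he.2, parity_of_mem_odd h ho.2]
    exact add_mem he.1 (neg_mem ho.1)
  · intro hN v hv
    have h1 := hN v hv
    obtain ⟨e, he, o, ho, rfl⟩ := exists_even_add_odd h v
    rw [map_add, parity_of_mem_even h he, parity_of_mem_odd h ho] at h1
    have h2 : e ∈ N := by
      have : e = (1 / 2 : ℂ) • ((e + o) + (e + -o)) := by module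
      rw [this]
      exact N.smul_mem _ (add_mem hv h1)
    exact Submodule.add_mem_sup ⟨h2, he⟩ ⟨(N.add_mem_iff_right h2).1 hv, ho⟩

theorem map_parity {f : V →ₗ[ℂ] V'} (he : ∀ v ∈ E, f v ∈ E') (ho : ∀ v ∈ O, f v ∈ O') (v : V) :
    f (parity E O h v) = parity E' O' h' (f v) := by
  obtain ⟨e, hev, o, hod, rfl⟩ := exists_even_add_odd h v
  simp only [map_add, map_neg, parity_of_mem_even h hev, parity_of_mem_odd h hod,
    parity_of_mem_even h' (he e hev), parity_of_mem_odd h' (ho o hod)]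

theorem map_parity_swap {f : V →ₗ[ℂ] V'} (he : ∀ v ∈ E, f v ∈ O') (ho : ∀ v ∈ O, f v ∈ E')
    (v : V) : f (parity E O h v) = -parity E' O' h' (f v) := by
  obtain ⟨e, hev, o, hod, rfl⟩ := exists_even_add_odd h v
  simp only [map_add, map_neg, parity_of_mem_even h hev, parity_of_mem_odd h hod,
    parity_of_mem_odd h' (he e hev), parity_of_mem_even h' (ho o hod)]
  abel

/-- The even part of an involution. -/
def evenPart (θ : V →ₗ[ℂ] V) : Submodule ℂ V := LinearMap.ker (θ - LinearMap.id)

/-- The odd part of an involution. -/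
def oddPart (θ : V →ₗ[ℂ] V) : Submodule ℂ V := LinearMap.ker (θ + LinearMap.id)

theorem mem_evenPart {θ : V →ₗ[ℂ] V} {v : V} : v ∈ evenPart θ ↔ θ v = v := by
  simp [evenPart, sub_eq_zero]

theorem mem_oddPart {θ : V →ₗ[ℂ] V} {v : V} : v ∈ oddPart θ ↔ θ v = -v := by
  simp [oddPart, add_eq_zero_iff_eq_neg]

theorem isCompl_evenPart_oddPart {θ : V →ₗ[ℂ] V} (hθ : ∀ v, θ (θ v) = v) :
    IsCompl (evenPart θ) (oddPart θ) := by
  refine IsCompl.of_eq ?_ ?_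
  · rw [eq_bot_iff]
    rintro v ⟨he, ho⟩
    have h1 := mem_evenPart.1 he
    rw [mem_oddPart.1 ho] at h1
    exact eq_zero_of_neg_eq_self h1
  · rw [eq_top_iff]
    intro v _
    have : v = (1 / 2 : ℂ) • (v + θ v) + (1 / 2 : ℂ) • (v - θ v) := by module
    rw [this]
    refine Submodule.add_mem_sup (mem_evenPart.2 ?_) (mem_oddPart.2 ?_)
    · rw [map_smul, map_add, hθ, add_comm]
    · rw [map_smul, map_sub, hθ, ← smul_neg, neg_sub]

theorem parity_evenPart_oddPart {θ : V →ₗ[ℂ] V} (hθ : ∀ v, θ (θ v) = v) (v : V) :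
    parity _ _ (isCompl_evenPart_oddPart hθ) v = θ v := by
  obtain ⟨e, he, o, ho, rfl⟩ := exists_even_add_odd (isCompl_evenPart_oddPart hθ) v
  rw [map_add, map_add, parity_of_mem_even _ he, parity_of_mem_odd _ ho, mem_evenPart.1 he,
    mem_oddPart.1 ho]

end Parity

section Supermodules

variable {L : GLSA}

/-- The parity involution of a `𝔤`-supermodule. -/
def SMod.par (M : SMod L) : M.carrier →ₗ[ℂ] M.carrier := parity M.ev M.od M.grading

/-- The parity involution of a `𝔤₀`-supermodule. -/
def SMod0.par (V : SMod0 L) : V.carrier →ₗ[ℂ] V.carrier := parity V.ev V.od V.grading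

theorem SMod.par_par (M : SMod L) (m : M.carrier) : M.par (M.par m) = m := parity_parity _ m

theorem SMod0.par_par (V : SMod0 L) (v : V.carrier) : V.par (V.par v) = v := parity_parity _ v

theorem SMod.isSubmod_iff (M : SMod L) (N : Submodule ℂ M.carrier) :
    M.IsSubmod N ↔ (∀ x, ∀ m ∈ N, M.act x m ∈ N) ∧ ∀ m ∈ N, M.par m ∈ N := by
  rw [SMod.IsSubmod, le_sup_inf_iff_parity M.grading]
  rfl

theorem SMod0.isSubmod_iff (V : SMod0 L) (N : Submodule ℂ V.carrier) :
    V.IsSubmod N ↔ (∀ x, ∀ v ∈ N, V.act x v ∈ N) ∧ ∀ v ∈ N, V.par v ∈ N := by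
  rw [SMod0.IsSubmod, le_sup_inf_iff_parity V.grading]
  rfl

theorem SMod.act_par (M : SMod L) {x : L.carrier} (hx : x ∈ L.g0) (m : M.carrier) :
    M.act x (M.par m) = M.par (M.act x m) :=
  map_parity M.grading M.grading (M.act_e_ev x hx) (M.act_e_od x hx) m

theorem SMod.act_par_odd (M : SMod L) {x : L.carrier} (hx : x ∈ L.odd) (m : M.carrier) :
    M.act x (M.par m) = -M.par (M.act x m) :=
  map_parity_swap M.grading M.grading (M.act_o_ev x hx) (M.act_o_od x hx) m

theorem SMod0.act_par (V : SMod0 L) (x : L.g0) (v : V.carrier) :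
    V.act x (V.par v) = V.par (V.act x v) :=
  map_parity V.grading V.grading (V.act_ev x) (V.act_od x) v

theorem SHom.map_par {M N : SMod L} (f : SHom M N) (m : M.carrier) :
    f.toLin (M.par m) = N.par (f.toLin m) :=
  map_parity M.grading N.grading f.map_ev f.map_od m

/-- A linear map commuting with the action and the parity involutions. -/
def SHom.ofPar {M N : SMod L} (f : M.carrier →ₗ[ℂ] N.carrier)
    (hpar : ∀ m, f (M.par m) = N.par (f m))
    (hact : ∀ x m, f (M.act x m) = N.act x (f m)) : SHom M N where
  toLin := f
  map_ev m hm := (mem_even_iff N.grading).2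
    ((hpar m).symm.trans (congrArg f (parity_of_mem_even M.grading hm)))
  map_od m hm := (mem_odd_iff N.grading).2
    ((hpar m).symm.trans ((congrArg f (parity_of_mem_odd M.grading hm)).trans (map_neg f m)))
  equivar := hact

theorem SHom.ext {M N : SMod L} {f g : SHom M N} (h : ∀ m, f.toLin m = g.toLin m) : f = g := by
  cases f
  cases g
  congr
  exact LinearMap.ext h

theorem GLSA.mem_odd_of_gneg {x : L.carrier} (hx : x ∈ L.gneg) : x ∈ L.odd :=
  Submodule.mem_sup_left hx

theorem GLSA.mem_odd_of_gpos {x : L.carrier} (hx : x ∈ L.gpos) : x ∈ L.odd :=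
  Submodule.mem_sup_right hx

theorem GLSA.exists_eq_add (L : GLSA) (x : L.carrier) :
    ∃ y ∈ L.gneg, ∃ h ∈ L.g0, ∃ p ∈ L.gpos, x = y + h + p := by
  obtain ⟨h, hh, o, ho, rfl⟩ := exists_even_add_odd L.oddCompl x
  obtain ⟨y, hy, p, hp, rfl⟩ := Submodule.mem_sup.1 ho
  exact ⟨y, hy, h, hh, p, hp, by abel⟩

theorem GLSA.exists_linearMap (L : GLSA) {Z : Type*} [AddCommGroup Z] [Module ℂ Z]
    (Y : L.gneg →ₗ[ℂ] Z) (H : L.g0 →ₗ[ℂ] Z) (X : L.gpos →ₗ[ℂ] Z) :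
    ∃ f : L.carrier →ₗ[ℂ] Z, (∀ y : L.gneg, f y = Y y) ∧ (∀ h : L.g0, f h = H h) ∧
      ∀ x : L.gpos, f x = X x := by
  have hn : IsCompl L.gneg (L.g0 ⊔ L.gpos) := by
    refine IsCompl.of_eq ?_ ?_
    · rw [eq_bot_iff]
      rintro y ⟨hy, hy'⟩
      obtain ⟨h, hh, p, hp, rfl⟩ := Submodule.mem_sup.1 hy'
      have h1 : h ∈ L.gneg ⊔ L.gpos := by
        have := sub_mem (Submodule.mem_sup_left hy : h + p ∈ L.gneg ⊔ L.gpos)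
          (Submodule.mem_sup_right hp)
        rwa [add_sub_cancel_right] at this
      obtain rfl := Submodule.disjoint_def.1 L.oddCompl.disjoint h hh h1
      rw [zero_add] at hy ⊢
      exact Submodule.disjoint_def.1 L.disjNP p hy hp
    · rw [← sup_assoc, sup_comm L.gneg, sup_assoc]
      exact L.oddCompl.sup_eq_top
  have hp : IsCompl L.gpos (L.g0 ⊔ L.gneg) := by
    refine IsCompl.of_eq ?_ ?_
    · rw [eq_bot_iff]
      rintro y ⟨hy, hy'⟩
      obtain ⟨h, hh, p, hp, rfl⟩ := Submodule.mem_sup.1 hy'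
      have h1 : h ∈ L.gneg ⊔ L.gpos := by
        have := sub_mem (Submodule.mem_sup_right hy : h + p ∈ L.gneg ⊔ L.gpos)
          (Submodule.mem_sup_left hp)
        rwa [add_sub_cancel_right] at this
      obtain rfl := Submodule.disjoint_def.1 L.oddCompl.disjoint h hh h1
      rw [zero_add] at hy ⊢
      exact Submodule.disjoint_def.1 L.disjNP p hp hy
    · rw [← sup_assoc, sup_comm L.gpos, sup_assoc, sup_comm L.gpos]
      exact L.oddCompl.sup_eq_top
  refine ⟨Y ∘ₗ L.gneg.projectionOnto _ hn + H ∘ₗ L.g0.projectionOnto _ L.oddCompl +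
    X ∘ₗ L.gpos.projectionOnto _ hp, fun y => ?_, fun h => ?_, fun x => ?_⟩
  · have h1 := (Submodule.projectionOnto_apply_eq_zero_iff L.oddCompl).2
      (Submodule.mem_sup_left y.2)
    have h2 := (Submodule.projectionOnto_apply_eq_zero_iff hp).2 (Submodule.mem_sup_right y.2)
    simp [h1, h2]
  · have h1 := (Submodule.projectionOnto_apply_eq_zero_iff hn).2 (Submodule.mem_sup_left h.2)
    have h2 := (Submodule.projectionOnto_apply_eq_zero_iff hp).2 (Submodule.mem_sup_left h.2)
    simp [h1, h2]
  · have h1 := (Submodule.projectionOnto_apply_eq_zero_iff L.oddCompl).2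
      (Submodule.mem_sup_right x.2)
    have h2 := (Submodule.projectionOnto_apply_eq_zero_iff hn).2 (Submodule.mem_sup_right x.2)
    simp [h1, h2]

/-- The bracket `𝔤₁ × 𝔤₋₁ → 𝔤₀`. -/
def GLSA.bracketPN (L : GLSA) : L.gpos →ₗ[ℂ] L.gneg →ₗ[ℂ] L.g0 :=
  LinearMap.mk₂ ℂ (fun x y => ⟨L.bracket x y, L.br_pn x x.2 y y.2⟩)
    (fun _ _ _ => by ext; simp) (fun _ _ _ => by ext; simp) (fun _ _ _ => by ext; simp)
    (fun _ _ _ => by ext; simp)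

/-- The bracket of `𝔤₀`. -/
def GLSA.bracket0 (L : GLSA) (h h' : L.g0) : L.g0 := ⟨L.bracket h h', L.br_00 h h.2 h' h'.2⟩

/-- A family of operators satisfying the defining relations gives a supermodule. -/
theorem SMod.exists_of_relations (L : GLSA) (Z : Type) [AddCommGroup Z] [Module ℂ Z]
    (θ : Z →ₗ[ℂ] Z) (Y : L.gneg →ₗ[ℂ] Module.End ℂ Z) (H : L.g0 →ₗ[ℂ] Module.End ℂ Z)
    (X : L.gpos →ₗ[ℂ] Module.End ℂ Z)
    (hθY : ∀ y z, θ (Y y z) = -Y y (θ z)) (hθH : ∀ h z, θ (H h z) = H h (θ z))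
    (hθX : ∀ x z, θ (X x z) = -X x (θ z))
    (hHY : ∀ h y z, Y (adNeg L h y) z = H h (Y y z) - Y y (H h z))
    (hHX : ∀ h x z, X (adPos L h x) z = H h (X x z) - X x (H h z))
    (hHH : ∀ h h' z, H (L.bracket0 h h') z = H h (H h' z) - H h' (H h z))
    (hXY : ∀ x y z, H (L.bracketPN x y) z = X x (Y y z) + Y y (X x z))
    (hYY : ∀ y y' z, Y y (Y y' z) + Y y' (Y y z) = 0)
    (hXX : ∀ x x' z, X x (X x' z) + X x' (X x z) = 0) :
    ∃ act : L.carrier →ₗ[ℂ] Module.End ℂ Z, (∀ y : L.gneg, act y = Y y) ∧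
      (∀ h : L.g0, act h = H h) ∧ (∀ x : L.gpos, act x = X x) ∧
      (∀ x ∈ L.g0, ∀ m, θ (act x m) = act x (θ m)) ∧
      (∀ x ∈ L.odd, ∀ m, θ (act x m) = -act x (θ m)) ∧
      (∀ x y : L.carrier, (x ∈ L.g0 ∨ y ∈ L.g0) → ∀ m,
        act (L.bracket x y) m = act x (act y m) - act y (act x m)) ∧
      (∀ x ∈ L.odd, ∀ y ∈ L.odd, ∀ m,
        act (L.bracket x y) m = act x (act y m) + act y (act x m)) := by
  obtain ⟨act, hY, hH, hX⟩ := L.exists_linearMap Y H X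
  refine ⟨act, hY, hH, hX, ?_, ?_, ?_, ?_⟩
  · intro x hx m
    simpa [hH ⟨x, hx⟩] using hθH ⟨x, hx⟩ m
  · intro x hx m
    obtain ⟨y, hy, p, hp, rfl⟩ := Submodule.mem_sup.1 hx
    have h1 := hθY ⟨y, hy⟩ m
    have h2 := hθX ⟨p, hp⟩ m
    rw [← hY] at h1
    rw [← hX] at h2
    simp only [map_add, LinearMap.add_apply, h1, h2, neg_add]
  · have key : ∀ x ∈ L.g0, ∀ y m,
        act (L.bracket x y) m = act x (act y m) - act y (act x m) := by
      intro x hx y m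
      obtain ⟨n, hn, h, hh, p, hp, rfl⟩ := L.exists_eq_add y
      have h1 := hHY ⟨x, hx⟩ ⟨n, hn⟩ m
      have h2 := hHH ⟨x, hx⟩ ⟨h, hh⟩ m
      have h3 := hHX ⟨x, hx⟩ ⟨p, hp⟩ m
      rw [← hY, ← hH, ← hY] at h1
      rw [← hH, ← hH, ← hH] at h2
      rw [← hX, ← hH, ← hX] at h3
      have e1 : act (L.bracket x n) m = act x (act n m) - act n (act x m) := h1
      have e2 : act (L.bracket x h) m = act x (act h m) - act h (act x m) := h2
      have e3 : act (L.bracket x p) m = act x (act p m) - act p (act x m) := h3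
      simp only [map_add, LinearMap.add_apply, e1, e2, e3]
      abel
    rintro x y (hx | hy) m
    · exact key x hx y m
    · have h1 := L.skew_e y hy x
      rw [← neg_eq_iff_eq_neg] at h1
      rw [← h1, map_neg, LinearMap.neg_apply, key y hy x m, neg_sub]
  · intro x hx y hy m
    obtain ⟨n, hn, p, hp, rfl⟩ := Submodule.mem_sup.1 hx
    obtain ⟨n', hn', p', hp', rfl⟩ := Submodule.mem_sup.1 hy
    have h1 := hYY ⟨n, hn⟩ ⟨n', hn'⟩ m
    have h2 := hXY ⟨p, hp⟩ ⟨n', hn'⟩ m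
    have h3 := hXY ⟨p', hp'⟩ ⟨n, hn⟩ m
    have h4 := hXX ⟨p, hp⟩ ⟨p', hp'⟩ m
    rw [← hY, ← hY] at h1
    rw [← hH, ← hX, ← hY] at h2 h3
    rw [← hX, ← hX] at h4
    have e2 : act (L.bracket p n') m = act p (act n' m) + act n' (act p m) := h2
    have e3 : act (L.bracket p' n) m = act p' (act n m) + act n (act p' m) := h3
    have e1 : act n (act n' m) = -act n' (act n m) := eq_neg_of_add_eq_zero_left h1
    have e4 : act p (act p' m) = -act p' (act p m) := eq_neg_of_add_eq_zero_left h4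
    have e5 : L.bracket n p' = L.bracket p' n :=
      L.skew_oo n (L.mem_odd_of_gneg hn) p' (L.mem_odd_of_gpos hp')
    simp only [map_add, LinearMap.add_apply, L.br_nn n hn n' hn', L.br_pp p hp p' hp', e5, e2, e3,
      e1, e4, map_zero, LinearMap.zero_apply]
    abel

/-- The supermodule with a given parity involution. -/
def SMod.ofPar (Z : Type) [AddCommGroup Z] [Module ℂ Z] (θ : Z →ₗ[ℂ] Z) (hθ : ∀ z, θ (θ z) = z)
    (act : L.carrier →ₗ[ℂ] Module.End ℂ Z)
    (he : ∀ x ∈ L.g0, ∀ m, θ (act x m) = act x (θ m))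
    (ho : ∀ x ∈ L.odd, ∀ m, θ (act x m) = -act x (θ m))
    (hbe : ∀ x y : L.carrier, (x ∈ L.g0 ∨ y ∈ L.g0) → ∀ m,
      act (L.bracket x y) m = act x (act y m) - act y (act x m))
    (hbo : ∀ x ∈ L.odd, ∀ y ∈ L.odd, ∀ m,
      act (L.bracket x y) m = act x (act y m) + act y (act x m)) : SMod L where
  carrier := Z
  act := act
  ev := evenPart θ
  od := oddPart θ
  grading := isCompl_evenPart_oddPart hθ
  act_e_ev x hx m hm := by rw [mem_evenPart] at *; rw [he x hx, hm]
  act_e_od x hx m hm := by rw [mem_oddPart] at *; rw [he x hx, hm, map_neg]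
  act_o_ev x hx m hm := by
    rw [mem_evenPart] at hm
    rw [mem_oddPart, ho x hx, hm]
  act_o_od x hx m hm := by
    rw [mem_oddPart] at hm
    rw [mem_evenPart, ho x hx, hm, map_neg, neg_neg]
  act_br_e := hbe
  act_br_oo := hbo

/-- The `𝔤₀`-supermodule with a given parity involution. -/
def SMod0.ofPar (Z : Type) [AddCommGroup Z] [Module ℂ Z] (θ : Z →ₗ[ℂ] Z) (hθ : ∀ z, θ (θ z) = z)
    (act : L.g0 →ₗ[ℂ] Module.End ℂ Z) (he : ∀ x m, θ (act x m) = act x (θ m))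
    (hb : ∀ x y m, act (L.bracket0 x y) m = act x (act y m) - act y (act x m)) : SMod0 L where
  carrier := Z
  act := act
  ev := evenPart θ
  od := oddPart θ
  grading := isCompl_evenPart_oddPart hθ
  act_ev x m hm := by rw [mem_evenPart] at *; rw [he, hm]
  act_od x m hm := by rw [mem_oddPart] at *; rw [he, hm, map_neg]
  act_br := hb

end Supermodules

section KacModule

open TensorProduct ExteriorAlgebra

variable {L : GLSA}

@[simp]
theorem coe_adNeg (h : L.g0) (y : L.gneg) : (adNeg L h y : L.carrier) = L.bracket h y := rfl

@[simp]
theorem coe_bracket0 (h h' : L.g0) : (L.bracket0 h h' : L.carrier) = L.bracket h h' := rfl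

theorem adNeg_add (h h' : L.g0) : adNeg L (h + h') = adNeg L h + adNeg L h' := by
  ext y
  simp

theorem adNeg_smul (c : ℂ) (h : L.g0) : adNeg L (c • h) = c • adNeg L h := by
  ext y
  simp

theorem adNeg_bracket0 (h h' : L.g0) :
    adNeg L (L.bracket0 h h') = adNeg L h ∘ₗ adNeg L h' - adNeg L h' ∘ₗ adNeg L h := by
  ext y
  simp [L.jacobi_e (h : L.carrier) h' y (Or.inl h.2)]

theorem adNeg_bracketPN_self (x : L.gpos) (y : L.gneg) : adNeg L (L.bracketPN x y) y = 0 := by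
  ext1
  have h1 := L.jacobi_oo x (L.mem_odd_of_gpos x.2) y (L.mem_odd_of_gneg y.2) y
  have h2 := L.skew_e (L.bracket x y) (L.br_pn x x.2 y y.2) y
  rw [L.br_nn y y.2 y y.2, map_zero] at h1
  refine eq_zero_of_neg_eq_self ?_
  change -(L.bracket (L.bracket x y) (y : L.carrier)) = L.bracket (L.bracket x y) (y : L.carrier)
  nth_rewrite 2 [h2]
  rw [sub_eq_zero.1 h1.symm]

/-- The carrier `Λ(𝔤₋₁) ⊗ V` of the Kac module. -/
abbrev KacCarrier (V : SMod0 L) : Type := ExteriorAlgebra ℂ L.gneg ⊗[ℂ] V.carrier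

/-- The action of `𝔤₋₁` on the Kac module. -/
def kacNeg (V : SMod0 L) : L.gneg →ₗ[ℂ] Module.End ℂ (KacCarrier V) :=
  (leftAct V.carrier).toLinearMap ∘ₗ ι ℂ

theorem kacNeg_apply (V : SMod0 L) (y : L.gneg) : kacNeg V y = leftAct V.carrier (ι ℂ y) := rfl

@[simp]
theorem kacNeg_tmul (V : SMod0 L) (y : L.gneg) (a : ExteriorAlgebra ℂ L.gneg) (v : V.carrier) :
    kacNeg V y (a ⊗ₜ v) = (ι ℂ y * a) ⊗ₜ v := rfl

theorem kac_induction {V : SMod0 L} {P : KacCarrier V → Prop}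
    (one : ∀ v, P (1 ⊗ₜ v)) (add : ∀ x y, P x → P y → P (x + y))
    (kacNeg : ∀ y x, P x → P (kacNeg V y x)) (z : KacCarrier V) : P z :=
  tensor_induction one add kacNeg z

/-- The action of `𝔤₀` on the Kac module. -/
def kacZero (V : SMod0 L) : L.g0 →ₗ[ℂ] Module.End ℂ (KacCarrier V) where
  toFun h := (derivation (adNeg L h)).rTensor V.carrier + (V.act h).lTensor _
  map_add' h h' := by
    rw [adNeg_add, derivation_add, map_add, LinearMap.rTensor_add, LinearMap.lTensor_add]
    abel
  map_smul' c h := by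
    rw [adNeg_smul, derivation_smul, map_smul, LinearMap.rTensor_smul, LinearMap.lTensor_smul,
      RingHom.id_apply, smul_add]

@[simp]
theorem kacZero_tmul (V : SMod0 L) (h : L.g0) (a : ExteriorAlgebra ℂ L.gneg) (v : V.carrier) :
    kacZero V h (a ⊗ₜ v) = derivation (adNeg L h) a ⊗ₜ v + a ⊗ₜ V.act h v := rfl

theorem kacZero_one_tmul (V : SMod0 L) (h : L.g0) (v : V.carrier) :
    kacZero V h (1 ⊗ₜ v) = 1 ⊗ₜ V.act h v := by
  simp [derivation_one]

theorem kacZero_kacNeg (V : SMod0 L) (h : L.g0) (y : L.gneg) (z : KacCarrier V) :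
    kacZero V h (kacNeg V y z) = kacNeg V (adNeg L h y) z + kacNeg V y (kacZero V h z) := by
  induction z using TensorProduct.induction_on with
  | zero => simp
  | add x y hx hy => simp only [map_add, hx, hy]; abel
  | tmul a v => simp [derivation_ι_mul, add_tmul, add_assoc]

theorem exists_kacPos (V : SMod0 L) (x : L.gpos) :
    ∃ T : Module.End ℂ (KacCarrier V), (∀ v, T (1 ⊗ₜ v) = 0) ∧
      ∀ y z, T (kacNeg V y z) = kacZero V (L.bracketPN x y) z - kacNeg V y (T z) := by
  refine exists_antiderivation (kacZero V ∘ₗ L.bracketPN x) fun y z => ?_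
  have h := kacZero_kacNeg V (L.bracketPN x y) y z
  rwa [adNeg_bracketPN_self, map_zero, LinearMap.zero_apply, zero_add] at h

/-- The action of an element of `𝔤₁` on the Kac module. -/
def kacPosFun (V : SMod0 L) (x : L.gpos) : Module.End ℂ (KacCarrier V) :=
  (exists_kacPos V x).choose

theorem kacPosFun_one_tmul (V : SMod0 L) (x : L.gpos) (v : V.carrier) :
    kacPosFun V x (1 ⊗ₜ v) = 0 := (exists_kacPos V x).choose_spec.1 v

theorem kacPosFun_kacNeg (V : SMod0 L) (x : L.gpos) (y : L.gneg) (z : KacCarrier V) :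
    kacPosFun V x (kacNeg V y z) = kacZero V (L.bracketPN x y) z - kacNeg V y (kacPosFun V x z) :=
  (exists_kacPos V x).choose_spec.2 y z

/-- The action of `𝔤₁` on the Kac module. -/
def kacPos (V : SMod0 L) : L.gpos →ₗ[ℂ] Module.End ℂ (KacCarrier V) where
  toFun := kacPosFun V
  map_add' x x' := by
    refine LinearMap.ext fun z => ?_
    rw [LinearMap.add_apply]
    induction z using kac_induction with
    | one v => simp only [kacPosFun_one_tmul, add_zero]
    | add z w hz hw =>
      simp only [map_add, hz, hw]
      abel
    | kacNeg y z hz =>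
      simp only [kacPosFun_kacNeg, map_add, hz, LinearMap.add_apply]
      abel
  map_smul' c x := by
    refine LinearMap.ext fun z => ?_
    rw [LinearMap.smul_apply]
    induction z using kac_induction with
    | one v => simp only [kacPosFun_one_tmul, smul_zero]
    | add z w hz hw => simp only [map_add, smul_add, hz, hw]
    | kacNeg y z hz =>
      simp only [kacPosFun_kacNeg, map_smul, hz, smul_sub, RingHom.id_apply, LinearMap.smul_apply]

theorem kacPos_one_tmul (V : SMod0 L) (x : L.gpos) (v : V.carrier) :
    kacPos V x (1 ⊗ₜ v) = 0 := kacPosFun_one_tmul V x v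

theorem kacPos_kacNeg (V : SMod0 L) (x : L.gpos) (y : L.gneg) (z : KacCarrier V) :
    kacPos V x (kacNeg V y z) = kacZero V (L.bracketPN x y) z - kacNeg V y (kacPos V x z) :=
  kacPosFun_kacNeg V x y z

theorem kacNeg_kacNeg (V : SMod0 L) (y y' : L.gneg) (z : KacCarrier V) :
    kacNeg V y (kacNeg V y' z) + kacNeg V y' (kacNeg V y z) = 0 := by
  simp only [kacNeg_apply]
  rw [← Module.End.mul_apply, ← Module.End.mul_apply, ← map_mul (leftAct V.carrier),
    ← map_mul (leftAct V.carrier), ← LinearMap.add_apply, ← map_add, ι_add_mul_swap, map_zero,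
    LinearMap.zero_apply]

theorem kacZero_bracket0 (V : SMod0 L) (h h' : L.g0) (z : KacCarrier V) :
    kacZero V (L.bracket0 h h') z =
      kacZero V h (kacZero V h' z) - kacZero V h' (kacZero V h z) := by
  induction z using kac_induction with
  | one v =>
    simp only [kacZero_one_tmul, ← tmul_sub]
    rw [← V.act_br]
    rfl
  | add z w hz hw => simp only [map_add, hz, hw]; abel
  | kacNeg y z hz =>
    simp only [kacZero_kacNeg, adNeg_bracket0, hz, map_add, LinearMap.sub_apply, map_sub,
      LinearMap.comp_apply]
    abel

theorem bracketPN_adNeg (h : L.g0) (x : L.gpos) (y : L.gneg) :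
    L.bracket0 h (L.bracketPN x y) =
      L.bracketPN (adPos L h x) y + L.bracketPN x (adNeg L h y) := by
  ext1
  exact L.jacobi_e (h : L.carrier) x y (Or.inl h.2)

theorem kacPos_adPos (V : SMod0 L) (h : L.g0) (x : L.gpos) (z : KacCarrier V) :
    kacPos V (adPos L h x) z = kacZero V h (kacPos V x z) - kacPos V x (kacZero V h z) := by
  induction z using kac_induction with
  | one v => simp only [kacZero_one_tmul, kacPos_one_tmul, map_zero, sub_zero]
  | add z w hz hw => simp only [map_add, hz, hw]; abel
  | kacNeg y z hz =>
    have h1 := kacZero_bracket0 V h (L.bracketPN x y) z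
    rw [bracketPN_adNeg, map_add, LinearMap.add_apply] at h1
    simp only [kacZero_kacNeg, kacPos_kacNeg, hz, map_add, map_sub, eq_sub_of_add_eq h1]
    abel

theorem adNeg_bracketPN_add (x x' : L.gpos) (y : L.gneg) :
    adPos L (L.bracketPN x y) x' + adPos L (L.bracketPN x' y) x = 0 := by
  ext1
  have h1 := L.jacobi_oo x (L.mem_odd_of_gpos x.2) x' (L.mem_odd_of_gpos x'.2) y
  rw [L.br_pp x x.2 x' x'.2, map_zero, LinearMap.zero_apply, zero_sub] at h1
  have h2 := L.skew_e (L.bracket x y) (L.br_pn x x.2 y y.2) x'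
  have h3 := L.skew_e (L.bracket x' y) (L.br_pn x' x'.2 y y.2) x
  change L.bracket (L.bracket x y) (x' : L.carrier) + L.bracket (L.bracket x' y) (x : L.carrier) = 0
  rw [h2, h3, h1]
  abel

theorem kacPos_kacPos (V : SMod0 L) (x x' : L.gpos) (z : KacCarrier V) :
    kacPos V x (kacPos V x' z) + kacPos V x' (kacPos V x z) = 0 := by
  induction z using kac_induction with
  | one v => simp only [kacPos_one_tmul, map_zero, add_zero]
  | add z w hz hw =>
    simp only [map_add]
    rw [add_add_add_comm, hz, hw, add_zero]
  | kacNeg y z hz =>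
    have h1 := congrArg (fun x => kacPos V x z) (adNeg_bracketPN_add x x' y)
    simp only [map_add, LinearMap.add_apply, kacPos_adPos, map_zero, LinearMap.zero_apply] at h1
    have h2 := congrArg (kacNeg V y) hz
    rw [map_add, map_zero] at h2
    simp only [kacPos_kacNeg, map_sub]
    linear_combination (norm := module) h2 - h1

/-- The parity involution of the Kac module. -/
def kacPar (V : SMod0 L) : Module.End ℂ (KacCarrier V) :=
  TensorProduct.map (ExteriorAlgebra.map (-LinearMap.id)).toLinearMap V.par

@[simp]
theorem kacPar_tmul (V : SMod0 L) (a : ExteriorAlgebra ℂ L.gneg) (v : V.carrier) :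
    kacPar V (a ⊗ₜ v) = ExteriorAlgebra.map (-LinearMap.id) a ⊗ₜ V.par v := rfl

theorem kacPar_kacNeg (V : SMod0 L) (y : L.gneg) (z : KacCarrier V) :
    kacPar V (kacNeg V y z) = -kacNeg V y (kacPar V z) := by
  induction z using TensorProduct.induction_on with
  | zero => simp
  | add x y hx hy => simp only [map_add, hx, hy]; abel
  | tmul a v => simp [neg_tmul]

theorem kacPar_kacPar (V : SMod0 L) (z : KacCarrier V) : kacPar V (kacPar V z) = z := by
  induction z using kac_induction with
  | one v => simp [V.par_par]
  | add z w hz hw => simp only [map_add, hz, hw]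
  | kacNeg y z hz => rw [kacPar_kacNeg, map_neg, kacPar_kacNeg, neg_neg, hz]

theorem kacPar_kacZero (V : SMod0 L) (h : L.g0) (z : KacCarrier V) :
    kacPar V (kacZero V h z) = kacZero V h (kacPar V z) := by
  induction z using kac_induction with
  | one v => simp [V.act_par, derivation_one]
  | add z w hz hw => simp only [map_add, hz, hw]
  | kacNeg y z hz =>
    simp only [kacPar_kacNeg, kacZero_kacNeg, map_add, map_neg, hz]
    abel

theorem kacPar_kacPos (V : SMod0 L) (x : L.gpos) (z : KacCarrier V) :
    kacPar V (kacPos V x z) = -kacPos V x (kacPar V z) := by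
  induction z using kac_induction with
  | one v => simp [kacPos_one_tmul]
  | add z w hz hw => simp only [map_add, hz, hw]; abel
  | kacNeg y z hz =>
    simp only [kacPar_kacNeg, kacPos_kacNeg, kacPar_kacZero, map_sub, map_neg, hz]
    abel

theorem exists_kacAct (V : SMod0 L) :
    ∃ act : L.carrier →ₗ[ℂ] Module.End ℂ (KacCarrier V), (∀ y : L.gneg, act y = kacNeg V y) ∧
      (∀ h : L.g0, act h = kacZero V h) ∧ (∀ x : L.gpos, act x = kacPos V x) ∧
      (∀ x ∈ L.g0, ∀ m, kacPar V (act x m) = act x (kacPar V m)) ∧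
      (∀ x ∈ L.odd, ∀ m, kacPar V (act x m) = -act x (kacPar V m)) ∧
      (∀ x y : L.carrier, (x ∈ L.g0 ∨ y ∈ L.g0) → ∀ m,
        act (L.bracket x y) m = act x (act y m) - act y (act x m)) ∧
      (∀ x ∈ L.odd, ∀ y ∈ L.odd, ∀ m,
        act (L.bracket x y) m = act x (act y m) + act y (act x m)) :=
  SMod.exists_of_relations L (KacCarrier V) (kacPar V) (kacNeg V) (kacZero V) (kacPos V)
    (kacPar_kacNeg V) (kacPar_kacZero V) (kacPar_kacPos V)
    (fun h y z => by rw [kacZero_kacNeg, add_sub_cancel_right]) (kacPos_adPos V)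
    (kacZero_bracket0 V) (fun x y z => by rw [kacPos_kacNeg, sub_add_cancel]) (kacNeg_kacNeg V)
    (kacPos_kacPos V)

/-- The Kac module `Λ(𝔤₋₁) ⊗ V`. -/
def kacModule (V : SMod0 L) : SMod L :=
  SMod.ofPar (KacCarrier V) (kacPar V) (kacPar_kacPar V) (exists_kacAct V).choose
    (exists_kacAct V).choose_spec.2.2.2.1 (exists_kacAct V).choose_spec.2.2.2.2.1
    (exists_kacAct V).choose_spec.2.2.2.2.2.1 (exists_kacAct V).choose_spec.2.2.2.2.2.2

theorem kacModule_par (V : SMod0 L) (z : KacCarrier V) :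
    (kacModule V).par (z : (kacModule V).carrier) = kacPar V z :=
  parity_evenPart_oddPart (kacPar_kacPar V) z

theorem kacModule_act_neg (V : SMod0 L) (y : L.gneg) (z : KacCarrier V) :
    (kacModule V).act y (z : (kacModule V).carrier) = kacNeg V y z :=
  LinearMap.congr_fun ((exists_kacAct V).choose_spec.1 y) z

theorem kacModule_act_zero (V : SMod0 L) (h : L.g0) (z : KacCarrier V) :
    (kacModule V).act h (z : (kacModule V).carrier) = kacZero V h z :=
  LinearMap.congr_fun ((exists_kacAct V).choose_spec.2.1 h) z

theorem kacModule_act_pos (V : SMod0 L) (x : L.gpos) (z : KacCarrier V) :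
    (kacModule V).act x (z : (kacModule V).carrier) = kacPos V x z :=
  LinearMap.congr_fun ((exists_kacAct V).choose_spec.2.2.1 x) z

end KacModule

section KacUniversal

open TensorProduct ExteriorAlgebra

variable {L : GLSA}

theorem SMod.act_act_self (M : SMod L) {y : L.carrier} (hy : y ∈ L.odd)
    (hyy : L.bracket y y = 0) (m : M.carrier) : M.act y (M.act y m) = 0 := by
  have h := M.act_br_oo y hy y hy m
  rw [hyy, map_zero, LinearMap.zero_apply] at h
  exact eq_zero_of_neg_eq_self (neg_eq_of_add_eq_zero_left h.symm)

/-- The action of the exterior algebra of a supercommutative odd subspace. -/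
def SMod.extAct (M : SMod L) {S : Submodule ℂ L.carrier} (hS : S ≤ L.odd)
    (h0 : ∀ x ∈ S, ∀ y ∈ S, L.bracket x y = 0) :
    ExteriorAlgebra ℂ S →ₐ[ℂ] Module.End ℂ M.carrier :=
  ExteriorAlgebra.lift ℂ ⟨M.act ∘ₗ S.subtype, fun y =>
    LinearMap.ext fun m => M.act_act_self (hS y.2) (h0 y y.2 y y.2) m⟩

theorem SMod.extAct_ι (M : SMod L) {S : Submodule ℂ L.carrier} (hS : S ≤ L.odd)
    (h0 : ∀ x ∈ S, ∀ y ∈ S, L.bracket x y = 0) (y : S) (m : M.carrier) :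
    M.extAct hS h0 (ι ℂ y) m = M.act y m := by
  rw [SMod.extAct, lift_ι_apply]
  rfl

theorem SMod.extAct_ι_mul (M : SMod L) {S : Submodule ℂ L.carrier} (hS : S ≤ L.odd)
    (h0 : ∀ x ∈ S, ∀ y ∈ S, L.bracket x y = 0) (y : S) (a : ExteriorAlgebra ℂ S)
    (m : M.carrier) : M.extAct hS h0 (ι ℂ y * a) m = M.act y (M.extAct hS h0 a m) := by
  rw [map_mul, Module.End.mul_apply, SMod.extAct_ι]

theorem SMod.extAct_mul_ι (M : SMod L) {S : Submodule ℂ L.carrier} (hS : S ≤ L.odd)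
    (h0 : ∀ x ∈ S, ∀ y ∈ S, L.bracket x y = 0) (y : S) (a : ExteriorAlgebra ℂ S)
    (m : M.carrier) : M.extAct hS h0 (a * ι ℂ y) m = M.extAct hS h0 a (M.act y m) := by
  rw [map_mul, Module.End.mul_apply, SMod.extAct_ι]

/-- The action of `Λ(𝔤₋₁)` on a supermodule. -/
def SMod.negAct (M : SMod L) : ExteriorAlgebra ℂ L.gneg →ₐ[ℂ] Module.End ℂ M.carrier :=
  M.extAct (fun _ => L.mem_odd_of_gneg) L.br_nn

/-- The action of `Λ(𝔤₁)` on a supermodule. -/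
def SMod.posAct (M : SMod L) : ExteriorAlgebra ℂ L.gpos →ₐ[ℂ] Module.End ℂ M.carrier :=
  M.extAct (fun _ => L.mem_odd_of_gpos) L.br_pp

theorem SMod.negAct_ι_mul (M : SMod L) (y : L.gneg) (a : ExteriorAlgebra ℂ L.gneg)
    (m : M.carrier) : M.negAct (ι ℂ y * a) m = M.act y (M.negAct a m) :=
  M.extAct_ι_mul _ _ y a m

theorem SMod.negAct_mul_ι (M : SMod L) (y : L.gneg) (a : ExteriorAlgebra ℂ L.gneg)
    (m : M.carrier) : M.negAct (a * ι ℂ y) m = M.negAct a (M.act y m) :=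
  M.extAct_mul_ι _ _ y a m

theorem SMod.negAct_one (M : SMod L) (m : M.carrier) : M.negAct 1 m = m := by
  rw [map_one, Module.End.one_apply]

theorem SMod.equivar_of_homogeneous {M N : SMod L} (f : M.carrier →ₗ[ℂ] N.carrier)
    (hn : ∀ (y : L.gneg) m, f (M.act y m) = N.act y (f m))
    (h0 : ∀ (h : L.g0) m, f (M.act h m) = N.act h (f m))
    (hp : ∀ (x : L.gpos) m, f (M.act x m) = N.act x (f m)) (x : L.carrier) (m : M.carrier) :
    f (M.act x m) = N.act x (f m) := by
  obtain ⟨y, hy, h, hh, p, hp', rfl⟩ := L.exists_eq_add x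
  have h1 := hn ⟨y, hy⟩ m
  have h2 := h0 ⟨h, hh⟩ m
  have h3 := hp ⟨p, hp'⟩ m
  simp only at h1 h2 h3
  simp only [map_add, LinearMap.add_apply, h1, h2, h3]

theorem SMod.act_adNeg (M : SMod L) (h : L.g0) (y : L.gneg) (m : M.carrier) :
    M.act (adNeg L h y) m = M.act h (M.act y m) - M.act y (M.act h m) :=
  M.act_br_e h y (Or.inl h.2) m

theorem SMod.act_bracketPN (M : SMod L) (x : L.gpos) (y : L.gneg) (m : M.carrier) :
    M.act (L.bracketPN x y) m = M.act x (M.act y m) + M.act y (M.act x m) :=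
  M.act_br_oo x (L.mem_odd_of_gpos x.2) y (L.mem_odd_of_gneg y.2) m

/-- The inclusion of `V` in its Kac module. -/
def kacUnit (V : SMod0 L) : V.carrier →ₗ[ℂ] (kacModule V).carrier :=
  TensorProduct.mk ℂ (ExteriorAlgebra ℂ L.gneg) V.carrier 1

theorem kacUnit_apply (V : SMod0 L) (v : V.carrier) :
    kacUnit V v = (1 ⊗ₜ[ℂ] v : KacCarrier V) := rfl

theorem kacUnit_injective (V : SMod0 L) : Injective (kacUnit V) := by
  have h : LeftInverse ((TensorProduct.lid ℂ V.carrier).toLinearMap ∘ₗ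
      (algebraMapInv (R := ℂ) (M := L.gneg)).toLinearMap.rTensor V.carrier) (kacUnit V) := by
    intro v
    change TensorProduct.lid ℂ V.carrier (algebraMapInv (1 : ExteriorAlgebra ℂ L.gneg) ⊗ₜ v) = v
    rw [map_one, TensorProduct.lid_tmul, one_smul]
  exact h.injective

section Lift

variable {V : SMod0 L} {M : SMod L} (φ : V.carrier →ₗ[ℂ] M.carrier)

/-- The linear map underlying the homomorphism from a Kac module induced by `φ`. -/
def kacLift : KacCarrier V →ₗ[ℂ] M.carrier :=
  TensorProduct.lift (LinearMap.lcomp ℂ M.carrier φ ∘ₗ M.negAct.toLinearMap)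

theorem kacLift_tmul (a : ExteriorAlgebra ℂ L.gneg) (v : V.carrier) :
    kacLift φ (a ⊗ₜ v) = M.negAct a (φ v) := rfl

theorem kacLift_one_tmul (v : V.carrier) : kacLift φ (1 ⊗ₜ v) = φ v := by
  rw [kacLift_tmul, map_one, Module.End.one_apply]

theorem kacLift_kacNeg (y : L.gneg) (z : KacCarrier V) :
    kacLift φ (kacNeg V y z) = M.act y (kacLift φ z) := by
  induction z using TensorProduct.induction_on with
  | zero => simp
  | add x y hx hy => simp only [map_add, hx, hy]
  | tmul a v => rw [kacNeg_tmul, kacLift_tmul, kacLift_tmul, M.negAct_ι_mul]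

variable {φ}

theorem kacLift_kacZero
    (h0 : ∀ (x : L.g0) (v : V.carrier), φ (V.act x v) = M.act x (φ v)) (h : L.g0)
    (z : KacCarrier V) : kacLift φ (kacZero V h z) = M.act h (kacLift φ z) := by
  induction z using kac_induction with
  | one v => rw [kacZero_one_tmul, kacLift_one_tmul, kacLift_one_tmul, h0]
  | add z w hz hw => simp only [map_add, hz, hw]
  | kacNeg y z hz =>
    rw [kacZero_kacNeg, map_add, kacLift_kacNeg, kacLift_kacNeg, kacLift_kacNeg, hz, M.act_adNeg]
    abel

theorem kacLift_kacPos
    (h0 : ∀ (x : L.g0) (v : V.carrier), φ (V.act x v) = M.act x (φ v))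
    (hp : ∀ x ∈ L.gpos, ∀ v : V.carrier, M.act x (φ v) = 0) (x : L.gpos)
    (z : KacCarrier V) : kacLift φ (kacPos V x z) = M.act x (kacLift φ z) := by
  induction z using kac_induction with
  | one v => rw [kacPos_one_tmul, kacLift_one_tmul, map_zero, hp x x.2]
  | add z w hz hw => simp only [map_add, hz, hw]
  | kacNeg y z hz =>
    rw [kacPos_kacNeg, map_sub, kacLift_kacNeg, kacLift_kacNeg, kacLift_kacZero h0, hz,
      M.act_bracketPN, add_sub_cancel_right]

theorem kacLift_kacPar (hpar : ∀ v, φ (V.par v) = M.par (φ v)) (z : KacCarrier V) :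
    kacLift φ (kacPar V z) = M.par (kacLift φ z) := by
  induction z using kac_induction with
  | one v => rw [kacPar_tmul, map_one, kacLift_one_tmul, kacLift_one_tmul, hpar]
  | add z w hz hw => simp only [map_add, hz, hw]
  | kacNeg y z hz =>
    rw [kacPar_kacNeg, map_neg, kacLift_kacNeg, kacLift_kacNeg, hz,
      M.act_par_odd (L.mem_odd_of_gneg y.2), neg_neg]

end Lift

theorem isKac_kacModule (V : SMod0 L) : IsKac V (kacModule V) (kacUnit V) := by
  have hpar (v : V.carrier) : (kacModule V).par (kacUnit V v) = kacUnit V (V.par v) := by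
    refine (kacModule_par V _).trans ?_
    rw [kacUnit_apply, kacPar_tmul, map_one, kacUnit_apply]
  refine ⟨fun v hv => ?_, fun v hv => ?_, fun x v => ?_, fun x hx v => ?_, kacUnit_injective V,
    ?_, ?_⟩
  · exact (mem_even_iff (kacModule V).grading).2
      ((hpar v).trans (congrArg _ (parity_of_mem_even V.grading hv)))
  · exact (mem_odd_iff (kacModule V).grading).2
      ((hpar v).trans ((congrArg _ (parity_of_mem_odd V.grading hv)).trans (map_neg _ _)))
  · exact ((kacModule_act_zero V x _).trans (kacZero_one_tmul V x v)).symm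
  · exact (kacModule_act_pos V ⟨x, hx⟩ _).trans (kacPos_one_tmul V ⟨x, hx⟩ v)
  · rw [SMod.gen, sInf_eq_top]
    rintro N ⟨hN, hη⟩
    rw [eq_top_iff]
    rintro z -
    induction z using kac_induction with
    | one v => exact hη ⟨v, rfl⟩
    | add z w hz hw => exact add_mem hz hw
    | kacNeg y z hz =>
      have := hN.1 y z hz
      rwa [kacModule_act_neg] at this
  · intro M φ he ho h0 hp
    refine ⟨SHom.ofPar (kacLift φ) (fun m => ?_) (SMod.equivar_of_homogeneous _
      (fun y m => ?_) (fun h m => ?_) (fun x m => ?_)), kacLift_one_tmul φ, fun Φ hΦ => ?_⟩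
    · exact (congrArg (kacLift φ) (kacModule_par V m)).trans
        (kacLift_kacPar (map_parity V.grading M.grading he ho) m)
    · exact (congrArg (kacLift φ) (kacModule_act_neg V y m)).trans (kacLift_kacNeg φ y m)
    · exact (congrArg (kacLift φ) (kacModule_act_zero V h m)).trans (kacLift_kacZero h0 h m)
    · exact (congrArg (kacLift φ) (kacModule_act_pos V x m)).trans (kacLift_kacPos h0 hp x m)
    · refine SHom.ext fun z => ?_
      change Φ.toLin z = kacLift φ z
      induction z using kac_induction with
      | one v => exact (hΦ v).trans (kacLift_one_tmul φ v).symm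
      | add z w hz hw =>
        rw [map_add, ← hz, ← hw]
        exact map_add Φ.toLin z w
      | kacNeg y z hz =>
        rw [kacLift_kacNeg, ← hz]
        exact (congrArg Φ.toLin (kacModule_act_neg V y z).symm).trans (Φ.equivar y z)

end KacUniversal

section Counit

open TensorProduct ExteriorAlgebra

variable {L : GLSA} [FiniteDimensional ℂ L.gneg]

/-- A basis of `𝔤₋₁`. -/
def GLSA.basisNeg (L : GLSA) [FiniteDimensional ℂ L.gneg] :
    Basis (Fin (finrank ℂ L.gneg)) ℂ L.gneg := finBasis ℂ L.gneg

/-- The character of `𝔤₀` on the top exterior power of `𝔤₋₁`. -/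
def GLSA.topChar (L : GLSA) [FiniteDimensional ℂ L.gneg] : L.g0 →ₗ[ℂ] ℂ where
  toFun h := topCoeff L.basisNeg (derivation (adNeg L h) (top L.basisNeg))
  map_add' h h' := by rw [adNeg_add, derivation_add, LinearMap.add_apply, map_add]
  map_smul' c h := by
    rw [adNeg_smul, derivation_smul, LinearMap.smul_apply, map_smul, RingHom.id_apply]

theorem topCoeff_derivation (h : L.g0) (a : ExteriorAlgebra ℂ L.gneg) :
    topCoeff L.basisNeg (derivation (adNeg L h) a) = L.topChar h * topCoeff L.basisNeg a :=
  topCoeff_apply _ _ (derivation_mem _) a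

theorem GLSA.topChar_bracket0 (h h' : L.g0) : L.topChar (L.bracket0 h h') = 0 := by
  change topCoeff L.basisNeg (derivation (adNeg L (L.bracket0 h h')) (top L.basisNeg)) = 0
  rw [adNeg_bracket0, derivation_lie, map_sub]
  simp only [topCoeff_derivation]
  ring

theorem topCoeff_map_neg (a : ExteriorAlgebra ℂ L.gneg) :
    topCoeff L.basisNeg (ExteriorAlgebra.map (-LinearMap.id) a) =
      (-1) ^ finrank ℂ L.gneg * topCoeff L.basisNeg a := by
  refine (topCoeff_apply L.basisNeg (ExteriorAlgebra.map (-LinearMap.id)).toLinearMap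
    (fun m a ha => ?_) a).trans ?_
  · rw [← ιMulti_span_fixedDegree] at ha
    refine (Submodule.span_le (p := (⋀[ℂ]^m L.gneg).comap
      (ExteriorAlgebra.map (-LinearMap.id)).toLinearMap)).2 ?_ ha
    rintro _ ⟨v, rfl⟩
    change ExteriorAlgebra.map (-LinearMap.id) (ιMulti ℂ m v) ∈ ⋀[ℂ]^m L.gneg
    rw [map_apply_ιMulti]
    exact ιMulti_range ℂ m ⟨_, rfl⟩
  · congr 1
    change topCoeff _ (ExteriorAlgebra.map (-LinearMap.id) (ιMulti ℂ _ L.basisNeg)) = _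
    rw [map_apply_ιMulti]
    have h : (⇑(-LinearMap.id : L.gneg →ₗ[ℂ] L.gneg) ∘ ⇑L.basisNeg) =
        fun i => (-1 : ℂ) • L.basisNeg i := by
      ext1 i
      simp
    rw [h, (ιMulti ℂ _).map_smul_univ (fun _ => (-1 : ℂ)) (⇑L.basisNeg), map_smul,
      topCoeff_ιMulti, Basis.det_self]
    simp

/-- The `𝔤₀`-supermodule `W` twisted by the dual of the top exterior power of `𝔤₋₁`. -/
def SMod0.untwist (W : SMod0 L) : SMod0 L :=
  SMod0.ofPar W.carrier ((-1 : ℂ) ^ finrank ℂ L.gneg • W.par)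
    (fun z => by
      rw [LinearMap.smul_apply, LinearMap.smul_apply, map_smul, W.par_par, smul_smul, ← mul_pow]
      simp)
    (W.act - L.topChar.smulRight LinearMap.id)
    (fun x m => by
      simp only [LinearMap.smul_apply, LinearMap.sub_apply, LinearMap.smulRight_apply,
        LinearMap.id_apply, map_smul, map_sub, W.act_par]
      module)
    (fun x y m => by
      have h := W.act_br x y m
      change W.act (L.bracket0 x y) m = _ at h
      simp only [LinearMap.sub_apply, LinearMap.smulRight_apply, LinearMap.smul_apply,
        LinearMap.id_apply, map_sub,
        map_smul, L.topChar_bracket0, h]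
      module)

/-- `e` identifies `V` with `W` twisted by the dual of the top exterior power of `𝔤₋₁`. -/
structure IsUntwist {V W : SMod0 L} (e : V.carrier ≃ₗ[ℂ] W.carrier) : Prop where
  act : ∀ h v, e (V.act h v) = W.act h (e v) - L.topChar h • e v
  par : ∀ v, e (V.par v) = (-1 : ℂ) ^ finrank ℂ L.gneg • W.par (e v)

theorem SMod0.exists_isUntwist (W : SMod0 L) :
    ∃ (V : SMod0 L) (e : V.carrier ≃ₗ[ℂ] W.carrier), IsUntwist e :=
  ⟨W.untwist, LinearEquiv.refl ℂ W.carrier, fun _ _ => rfl, fun v =>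
    parity_evenPart_oddPart (θ := (-1 : ℂ) ^ finrank ℂ L.gneg • W.par) (fun z => by
      rw [LinearMap.smul_apply, LinearMap.smul_apply, map_smul, W.par_par, smul_smul, ← mul_pow]
      simp) v⟩

variable {V W : SMod0 L} (e : V.carrier ≃ₗ[ℂ] W.carrier)

theorem IsUntwist.isSimple {e : V.carrier ≃ₗ[ℂ] W.carrier} (he : IsUntwist e)
    (hW : W.IsSimple) : V.IsSimple := by
  constructor
  · intro h
    refine hW.1 (eq_bot_iff.2 fun w _ => ?_)
    have h1 : e.symm w ∈ (⊥ : Submodule ℂ V.carrier) := h ▸ Submodule.mem_top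
    rwa [Submodule.mem_bot, LinearEquiv.map_eq_zero_iff] at h1
  · intro N hN
    rw [SMod0.isSubmod_iff] at hN
    have h1 := hW.2 (N.map e.toLinearMap) ((SMod0.isSubmod_iff _ _).2 ⟨?_, ?_⟩)
    · refine h1.imp (fun h => (Submodule.map_eq_bot_iff (e := e)).1 h) fun h => ?_
      exact (Submodule.map_eq_top_iff (e := e)).1 h
    · rintro x _ ⟨v, hv, rfl⟩
      refine ⟨V.act x v + L.topChar x • v, add_mem (hN.1 x v hv) (N.smul_mem _ hv), ?_⟩
      simp [he.act]
    · rintro _ ⟨v, hv, rfl⟩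
      refine ⟨(-1 : ℂ) ^ finrank ℂ L.gneg • V.par v, N.smul_mem _ (hN.2 v hv), ?_⟩
      simp [he.par, smul_smul, ← mul_pow]

/-- The projection of the Kac module on its bottom layer. -/
def kacCounit : KacCarrier V →ₗ[ℂ] W.carrier :=
  TensorProduct.lift ((topCoeff L.basisNeg).smulRight e.toLinearMap)

theorem kacCounit_tmul (a : ExteriorAlgebra ℂ L.gneg) (v : V.carrier) :
    kacCounit e (a ⊗ₜ v) = topCoeff L.basisNeg a • e v := rfl

variable {e}

theorem IsUntwist.kacCounit_kacZero (he : IsUntwist e) (h : L.g0) (z : KacCarrier V) :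
    kacCounit e (kacZero V h z) = W.act h (kacCounit e z) := by
  induction z using TensorProduct.induction_on with
  | zero => simp
  | add x y hx hy => simp only [map_add, hx, hy]
  | tmul a v =>
    rw [kacZero_tmul, map_add, kacCounit_tmul, kacCounit_tmul, kacCounit_tmul, he.act,
      topCoeff_derivation, map_smul]
    module

theorem IsUntwist.kacCounit_kacPar (he : IsUntwist e) (z : KacCarrier V) :
    kacCounit e (kacPar V z) = W.par (kacCounit e z) := by
  induction z using TensorProduct.induction_on with
  | zero => simp
  | add x y hx hy => simp only [map_add, hx, hy]
  | tmul a v =>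
    rw [kacPar_tmul, kacCounit_tmul, kacCounit_tmul, he.par, topCoeff_map_neg, map_smul, smul_smul,
      mul_right_comm, ← mul_pow]
    simp

/-- The graded pieces of the Kac module, shifted by one. -/
def kacLayer (V : SMod0 L) : ℕ → Submodule ℂ (KacCarrier V)
  | 0 => ⊥
  | m + 1 => Submodule.span ℂ {z | ∃ a ∈ ⋀[ℂ]^m L.gneg, ∃ v, z = a ⊗ₜ v}

omit [FiniteDimensional ℂ L.gneg] in
theorem tmul_mem_kacLayer {m : ℕ} {a : ExteriorAlgebra ℂ L.gneg} (ha : a ∈ ⋀[ℂ]^m L.gneg)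
    (v : V.carrier) : a ⊗ₜ v ∈ kacLayer V (m + 1) := Submodule.subset_span ⟨a, ha, v, rfl⟩

omit [FiniteDimensional ℂ L.gneg] in
theorem kacNeg_mem_kacLayer (y : L.gneg) {m : ℕ} {z : KacCarrier V} (hz : z ∈ kacLayer V m) :
    kacNeg V y z ∈ kacLayer V (m + 1) := by
  cases m with
  | zero =>
    rw [(Submodule.mem_bot ℂ).1 hz, map_zero]
    exact zero_mem _
  | succ m =>
    refine (Submodule.span_le (p := (kacLayer V (m + 2)).comap (kacNeg V y))).2 ?_ hz
    rintro _ ⟨a, ha, v, rfl⟩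
    exact tmul_mem_kacLayer (ι_mul_mem_exteriorPower y ha) v

omit [FiniteDimensional ℂ L.gneg] in
theorem kacPos_tmul_mem_kacLayer (x : L.gpos) (v : V.carrier) {m : ℕ}
    {a : ExteriorAlgebra ℂ L.gneg} (ha : a ∈ ⋀[ℂ]^m L.gneg) :
    kacPos V x (a ⊗ₜ v) ∈ kacLayer V m := by
  induction ha using Submodule.pow_induction_on_left' with
  | algebraMap r =>
    rw [Algebra.algebraMap_eq_smul_one, smul_tmul, kacPos_one_tmul]
    exact zero_mem _
  | add a b i _ _ ha hb =>
    rw [add_tmul, map_add]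
    exact add_mem ha hb
  | mem_mul y hy i a ha hia =>
    obtain ⟨y, rfl⟩ := hy
    rw [← kacNeg_tmul, kacPos_kacNeg]
    refine sub_mem ?_ (kacNeg_mem_kacLayer y hia)
    rw [kacZero_tmul]
    exact add_mem (tmul_mem_kacLayer (derivation_mem _ _ _ ha) v) (tmul_mem_kacLayer ha _)

theorem kacCounit_kacPos (e : V.carrier ≃ₗ[ℂ] W.carrier) (x : L.gpos) (z : KacCarrier V) :
    kacCounit e (kacPos V x z) = 0 := by
  induction z using TensorProduct.induction_on with
  | zero => simp
  | add x y hx hy => rw [map_add, map_add, hx, hy, add_zero]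
  | tmul a v =>
    induction a using DirectSum.Decomposition.inductionOn (fun i => ⋀[ℂ]^i L.gneg) with
    | zero => simp
    | add a a' ha ha' => rw [add_tmul, map_add, map_add, ha, ha', add_zero]
    | @homogeneous m a =>
      obtain ⟨a, ha⟩ := a
      rcases eq_or_ne m (finrank ℂ L.gneg + 1) with rfl | hm
      · rw [exteriorPower_eq_bot (by simp), Submodule.mem_bot] at ha
        simp [ha]
      · have h := kacPos_tmul_mem_kacLayer x v ha
        cases m with
        | zero => rw [(Submodule.mem_bot ℂ).1 h, map_zero]
        | succ m =>
          refine (Submodule.span_le (p := LinearMap.ker (kacCounit e))).2 ?_ h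
          rintro _ ⟨a, ha, v, rfl⟩
          change kacCounit e _ = 0
          rw [kacCounit_tmul, topCoeff_eq_zero _ (by simpa using hm) ha, zero_smul]

variable (e) in
theorem exists_kacEquiv : ∃ F : KacCarrier V ≃ₗ[ℂ] (ExteriorAlgebra ℂ L.gneg →ₗ[ℂ] W.carrier),
    ∀ z ω, F z ω = kacCounit e (leftAct V.carrier ω z) := by
  let G : ExteriorAlgebra ℂ L.gneg →ₗ[ℂ] Dual ℂ (ExteriorAlgebra ℂ L.gneg) :=
    (LinearMap.mul ℂ _).flip.compr₂ (topCoeff L.basisNeg)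
  have hG (a ω) : G a ω = topCoeff L.basisNeg (ω * a) := rfl
  have hinj : Injective G := by
    rw [injective_iff_map_eq_zero]
    intro a ha
    by_contra h
    obtain ⟨w, hw⟩ := exists_topCoeff_mul_ne_zero L.basisNeg h
    exact hw (by rw [← hG, ha, LinearMap.zero_apply])
  refine ⟨(TensorProduct.congr (G.linearEquivOfInjective hinj Subspace.dual_finrank_eq.symm) e).trans
    (dualTensorHomEquiv ℂ _ _), fun z ω => ?_⟩
  induction z using TensorProduct.induction_on with
  | zero => simp
  | add x y hx hy => simp only [map_add, LinearMap.add_apply, hx, hy]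
  | tmul a v =>
    rw [leftAct_tmul, kacCounit_tmul, ← hG]
    simp

end Counit

section CoindUniversal

open TensorProduct ExteriorAlgebra

variable {L : GLSA}

theorem SHom.map_negAct {M N : SMod L} (f : SHom M N) (ω : ExteriorAlgebra ℂ L.gneg)
    (m : M.carrier) : f.toLin (M.negAct ω m) = N.negAct ω (f.toLin m) := by
  induction ω using ExteriorAlgebra.left_induction' with
  | one => simp only [SMod.negAct_one]
  | add x y hx hy => simp only [map_add, LinearMap.add_apply, hx, hy]
  | smul c x hx => simp only [map_smul, LinearMap.smul_apply, hx]
  | ι_mul y x hx => rw [SMod.negAct_ι_mul, SMod.negAct_ι_mul, f.equivar, hx]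

theorem leftAct_mul_ι {V : SMod0 L} (ω : ExteriorAlgebra ℂ L.gneg) (y : L.gneg) (z : KacCarrier V) :
    leftAct V.carrier (ω * ι ℂ y) z = leftAct V.carrier ω (kacNeg V y z) := by
  rw [map_mul]
  rfl

theorem leftAct_one_apply {V : SMod0 L} (z : KacCarrier V) :
    leftAct (k := ℂ) (N := L.gneg) V.carrier 1 z = z := by
  rw [map_one, Module.End.one_apply]

theorem kacModule_negAct (V : SMod0 L) (ω : ExteriorAlgebra ℂ L.gneg)
    (z : KacCarrier V) :
    (kacModule V).negAct ω (z : (kacModule V).carrier) = leftAct V.carrier ω z := by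
  have h : (kacModule V).negAct = leftAct V.carrier := by
    refine ExteriorAlgebra.hom_ext (LinearMap.ext fun y => LinearMap.ext fun z => ?_)
    exact ((kacModule V).extAct_ι (fun _ => L.mem_odd_of_gneg) L.br_nn y z).trans
      (kacModule_act_neg V y z)
  exact LinearMap.congr_fun (DFunLike.congr_fun h ω) z

variable [FiniteDimensional ℂ L.gneg] {V W : SMod0 L} {e : V.carrier ≃ₗ[ℂ] W.carrier}

theorem kac_ext (e : V.carrier ≃ₗ[ℂ] W.carrier) {z z' : KacCarrier V}
    (h : ∀ ω, kacCounit e (leftAct V.carrier ω z) = kacCounit e (leftAct V.carrier ω z')) :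
    z = z' := by
  obtain ⟨F, hF⟩ := exists_kacEquiv e
  refine F.injective (LinearMap.ext fun ω => ?_)
  rw [hF, hF, h]

theorem exists_kacColift {M : SMod L} (e : V.carrier ≃ₗ[ℂ] W.carrier)
    (ψ : M.carrier →ₗ[ℂ] W.carrier) :
    ∃ Φ : M.carrier →ₗ[ℂ] KacCarrier V,
      ∀ m ω, kacCounit e (leftAct V.carrier ω (Φ m)) = ψ (M.negAct ω m) := by
  obtain ⟨F, hF⟩ := exists_kacEquiv e
  refine ⟨F.symm.toLinearMap ∘ₗ M.negAct.toLinearMap.flip.compr₂ ψ, fun m ω => ?_⟩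
  rw [← hF]
  simp

section Colift

variable {M : SMod L} {ψ : M.carrier →ₗ[ℂ] W.carrier} {Φ : M.carrier →ₗ[ℂ] KacCarrier V}
  (hΦ : ∀ m ω, kacCounit e (leftAct V.carrier ω (Φ m)) = ψ (M.negAct ω m))

include hΦ

theorem kacColift_counit (m : M.carrier) : kacCounit e (Φ m) = ψ m := by
  have h := hΦ m 1
  rwa [map_one, M.negAct_one, Module.End.one_apply] at h

theorem kacColift_neg (y : L.gneg) (m : M.carrier) : Φ (M.act y m) = kacNeg V y (Φ m) := by
  refine kac_ext e fun ω => ?_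
  rw [hΦ, ← M.negAct_mul_ι, ← hΦ, map_mul]
  rfl

theorem kacColift_zero (he : IsUntwist e)
    (h0 : ∀ (x : L.g0) (m : M.carrier), ψ (M.act x m) = W.act x (ψ m)) (h : L.g0)
    (m : M.carrier) : Φ (M.act h m) = kacZero V h (Φ m) := by
  refine kac_ext e fun ω => ?_
  rw [hΦ]
  induction ω using ExteriorAlgebra.right_induction' generalizing m with
  | one =>
    rw [M.negAct_one, leftAct_one_apply, he.kacCounit_kacZero, kacColift_counit hΦ, h0]
  | add x y hx hy => simp only [map_add, LinearMap.add_apply, hx, hy]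
  | smul c x hx => simp only [map_smul, LinearMap.smul_apply, hx]
  | mul_ι y ω ih =>
    have h1 := kacZero_kacNeg V h y (Φ m)
    rw [← kacColift_neg hΦ, ← kacColift_neg hΦ] at h1
    rw [leftAct_mul_ι, M.negAct_mul_ι, eq_sub_of_add_eq' h1.symm, map_sub, map_sub, ← ih, hΦ,
      M.act_adNeg, map_sub, map_sub, sub_sub_cancel]

theorem kacColift_pos (he : IsUntwist e)
    (h0 : ∀ (x : L.g0) (m : M.carrier), ψ (M.act x m) = W.act x (ψ m))
    (hp : ∀ x ∈ L.gpos, ∀ m : M.carrier, ψ (M.act x m) = 0) (x : L.gpos)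
    (m : M.carrier) : Φ (M.act x m) = kacPos V x (Φ m) := by
  refine kac_ext e fun ω => ?_
  rw [hΦ]
  induction ω using ExteriorAlgebra.right_induction' generalizing m with
  | one =>
    rw [M.negAct_one, leftAct_one_apply, kacCounit_kacPos, hp x x.2]
  | add x y hx hy => simp only [map_add, LinearMap.add_apply, hx, hy]
  | smul c x hx => simp only [map_smul, LinearMap.smul_apply, hx]
  | mul_ι y ω ih =>
    have h1 := kacPos_kacNeg V x y (Φ m)
    rw [← kacColift_neg hΦ, ← kacColift_zero hΦ he h0, eq_sub_iff_add_eq] at h1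
    rw [leftAct_mul_ι, M.negAct_mul_ι, eq_sub_of_add_eq' h1, map_sub, map_sub, ← ih, hΦ,
      M.act_bracketPN, map_add, map_add, add_sub_cancel_left]

theorem kacColift_par (he : IsUntwist e)
    (hpar : ∀ m : M.carrier, ψ (M.par m) = W.par (ψ m))
    (m : M.carrier) : Φ (M.par m) = kacPar V (Φ m) := by
  refine kac_ext e fun ω => ?_
  rw [hΦ]
  induction ω using ExteriorAlgebra.right_induction' generalizing m with
  | one =>
    rw [M.negAct_one, leftAct_one_apply, he.kacCounit_kacPar, kacColift_counit hΦ, hpar]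
  | add x y hx hy => simp only [map_add, LinearMap.add_apply, hx, hy]
  | smul c x hx => simp only [map_smul, LinearMap.smul_apply, hx]
  | mul_ι y ω ih =>
    have h1 := kacPar_kacNeg V y (Φ m)
    rw [← kacColift_neg hΦ, ← neg_eq_iff_eq_neg] at h1
    rw [leftAct_mul_ι, M.negAct_mul_ι, ← h1, map_neg, map_neg, ← ih,
      M.act_par_odd (L.mem_odd_of_gneg y.2), map_neg, map_neg]

end Colift

theorem IsUntwist.isCoindPos (he : IsUntwist e) :
    IsCoindPos W (kacModule V) (kacCounit e) := by
  have hpar (z : (kacModule V).carrier) :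
      kacCounit e ((kacModule V).par z) = W.par (kacCounit e z) :=
    (congrArg (kacCounit e) (kacModule_par V z)).trans (he.kacCounit_kacPar z)
  refine ⟨fun z hz => ?_, fun z hz => ?_, fun x z => ?_, fun x hx z => ?_, ?_⟩
  · exact (mem_even_iff W.grading).2
      ((hpar z).symm.trans (congrArg (kacCounit e) (parity_of_mem_even (kacModule V).grading hz)))
  · exact (mem_odd_iff W.grading).2
      ((hpar z).symm.trans ((congrArg (kacCounit e)
        (parity_of_mem_odd (kacModule V).grading hz)).trans (map_neg (kacCounit e) z)))
  · exact (congrArg (kacCounit e) (kacModule_act_zero V x z)).trans (he.kacCounit_kacZero x z)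
  · exact (congrArg (kacCounit e) (kacModule_act_pos V ⟨x, hx⟩ z)).trans
      (kacCounit_kacPos e ⟨x, hx⟩ z)
  · intro M ψ hev hod h0 hp
    obtain ⟨Φ, hΦ⟩ := exists_kacColift e ψ
    refine ⟨SHom.ofPar (N := kacModule V) Φ (fun m => ?_)
      (SMod.equivar_of_homogeneous (N := kacModule V) Φ
        (fun y m => ?_) (fun h m => ?_) (fun x m => ?_)), kacColift_counit hΦ, fun f hf => ?_⟩
    · exact (kacColift_par hΦ he (map_parity M.grading W.grading hev hod) m).trans
        (kacModule_par V _).symm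
    · exact (kacColift_neg hΦ y m).trans (kacModule_act_neg V y _).symm
    · exact (kacColift_zero hΦ he h0 h m).trans (kacModule_act_zero V h _).symm
    · exact (kacColift_pos hΦ he h0 hp x m).trans (kacModule_act_pos V x _).symm
    · refine SHom.ext fun m => kac_ext e fun ω => ?_
      refine Eq.trans ?_ (hΦ m ω).symm
      rw [← hf]
      exact (congrArg (kacCounit e)
        ((f.map_negAct ω m).trans (kacModule_negAct V ω (f.toLin m)))).symm

end CoindUniversal

section TopQuotient

open ExteriorAlgebra

variable {L : GLSA} (M : SMod L)

/-- The algebra of operators generated by `𝔤₀` and the parity involution. -/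
def SMod.evenAlg : Subalgebra ℂ (Module.End ℂ M.carrier) :=
  Algebra.adjoin ℂ (insert M.par (Set.range fun h : L.g0 => M.act h))

theorem SMod.par_mem_evenAlg : M.par ∈ M.evenAlg :=
  Algebra.subset_adjoin (Set.mem_insert _ _)

theorem SMod.act_mem_evenAlg (h : L.g0) : M.act h ∈ M.evenAlg :=
  Algebra.subset_adjoin (Set.mem_insert_of_mem _ ⟨h, rfl⟩)

variable {M}

theorem SMod.par_mem (P : Submodule M.evenAlg M.carrier) {m : M.carrier} (hm : m ∈ P) :
    M.par m ∈ P := P.smul_mem ⟨M.par, M.par_mem_evenAlg⟩ hm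

theorem SMod.act_mem (P : Submodule M.evenAlg M.carrier) (h : L.g0) {m : M.carrier}
    (hm : m ∈ P) : M.act h m ∈ P := P.smul_mem ⟨M.act h, M.act_mem_evenAlg h⟩ hm

/-- A graded `𝔤₀`-stable subspace, as a module over the algebra of even operators. -/
def SMod.evenSubmodule (N : Submodule ℂ M.carrier) (h0 : ∀ h : L.g0, ∀ m ∈ N, M.act h m ∈ N)
    (hpar : ∀ m ∈ N, M.par m ∈ N) : Submodule M.evenAlg M.carrier where
  carrier := N
  add_mem' := N.add_mem
  zero_mem' := N.zero_mem
  smul_mem' := by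
    rintro ⟨a, ha⟩ m hm
    change a m ∈ N
    induction ha using Algebra.adjoin_induction generalizing m with
    | mem a ha =>
      rcases ha with rfl | ⟨h, rfl⟩
      · exact hpar m hm
      · exact h0 h m hm
    | algebraMap r => exact N.smul_mem r hm
    | add a b _ _ ha hb => exact N.add_mem (ha hm) (hb hm)
    | mul a b _ _ ha hb => exact ha (hb hm)

theorem SMod.posAct_ι_mul (M : SMod L) (x : L.gpos) (a : ExteriorAlgebra ℂ L.gpos)
    (m : M.carrier) : M.posAct (ι ℂ x * a) m = M.act x (M.posAct a m) :=
  M.extAct_ι_mul _ _ x a m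

theorem SMod.posAct_mul_ι (M : SMod L) (x : L.gpos) (a : ExteriorAlgebra ℂ L.gpos)
    (m : M.carrier) : M.posAct (a * ι ℂ x) m = M.posAct a (M.act x m) :=
  M.extAct_mul_ι _ _ x a m

theorem SMod.act_adPos (M : SMod L) (h : L.g0) (x : L.gpos) (m : M.carrier) :
    M.act (adPos L h x) m = M.act h (M.act x m) - M.act x (M.act h m) :=
  M.act_br_e h x (Or.inl h.2) m

theorem SMod.IsSimple.finite_evenAlg [FiniteDimensional ℂ L.gneg] [FiniteDimensional ℂ L.gpos]
    (hM : M.IsSimple) : Module.Finite M.evenAlg M.carrier := by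
  obtain ⟨m₀, -, hm₀⟩ := (Submodule.ne_bot_iff _).1 hM.1
  let f := M.posAct.toLinearMap.compl₂ (M.negAct.toLinearMap.flip m₀)
  obtain ⟨s, hs⟩ : (Submodule.map₂ f ⊤ ⊤).FG := Submodule.FG.map₂ f Module.Finite.fg_top
    Module.Finite.fg_top
  refine ⟨s, ?_⟩
  let Q := Submodule.span M.evenAlg (s : Set M.carrier)
  have hQ (ω ω') : M.posAct ω (M.negAct ω' m₀) ∈ Q := by
    have h1 : Submodule.map₂ f ⊤ ⊤ ≤ Q.restrictScalars ℂ := by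
      rw [← hs, Submodule.span_le]
      exact Submodule.subset_span
    exact h1 (Submodule.apply_mem_map₂ f (m := ω) (n := ω') trivial trivial)
  have hQind (N : Submodule M.evenAlg M.carrier)
      (hN : ∀ ω ω', M.posAct ω (M.negAct ω' m₀) ∈ N) : Q ≤ N := by
    have h1 : Submodule.map₂ f ⊤ ⊤ ≤ N.restrictScalars ℂ :=
      Submodule.map₂_le.2 fun ω _ ω' _ => hN ω ω'
    refine Submodule.span_le.2 fun m hm => h1 ?_
    rw [← hs]
    exact Submodule.subset_span hm
  have hpos (x : L.gpos) (m : M.carrier) (hm : m ∈ Q) : M.act x m ∈ Q := by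
    let N : Submodule ℂ M.carrier := ⨅ x : L.gpos, (Q.restrictScalars ℂ).comap (M.act x)
    have hN (m : M.carrier) : m ∈ N ↔ ∀ x : L.gpos, M.act x m ∈ Q := by
      simp only [N, Submodule.mem_iInf]
      rfl
    have h1 : Q ⊓ SMod.evenSubmodule (N ⊓ Q.restrictScalars ℂ) ?_ ?_ ≥ Q := ?_
    · exact (hN m).1 (h1 hm).2.1 x
    · refine fun h m hm => ⟨(hN _).2 fun x => ?_, SMod.act_mem Q h hm.2⟩
      have h2 := M.act_adPos h x m
      rw [eq_sub_iff_add_eq, ← eq_sub_iff_add_eq'] at h2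
      rw [h2]
      exact Q.sub_mem (SMod.act_mem Q h ((hN m).1 hm.1 x)) ((hN m).1 hm.1 _)
    · refine fun m hm => ⟨(hN _).2 fun x => ?_, SMod.par_mem Q hm.2⟩
      rw [M.act_par_odd (L.mem_odd_of_gpos x.2)]
      exact Q.neg_mem (SMod.par_mem Q ((hN m).1 hm.1 x))
    · refine hQind _ fun ω ω' => ⟨hQ ω ω', (hN _).2 fun x => ?_, hQ ω ω'⟩
      rw [← M.posAct_ι_mul]
      exact hQ _ _
  have hneg (y : L.gneg) (m : M.carrier) (hm : m ∈ Q) : M.act y m ∈ Q := by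
    let N : Submodule ℂ M.carrier := ⨅ y : L.gneg, (Q.restrictScalars ℂ).comap (M.act y)
    have hN (m : M.carrier) : m ∈ N ↔ ∀ y : L.gneg, M.act y m ∈ Q := by
      simp only [N, Submodule.mem_iInf]
      rfl
    have h1 : Q ⊓ SMod.evenSubmodule (N ⊓ Q.restrictScalars ℂ) ?_ ?_ ≥ Q := ?_
    · exact (hN m).1 (h1 hm).2.1 y
    · refine fun h m hm => ⟨(hN _).2 fun y => ?_, SMod.act_mem Q h hm.2⟩
      have h2 := M.act_adNeg h y m
      rw [eq_sub_iff_add_eq, ← eq_sub_iff_add_eq'] at h2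
      rw [h2]
      exact Q.sub_mem (SMod.act_mem Q h ((hN m).1 hm.1 y)) ((hN m).1 hm.1 _)
    · refine fun m hm => ⟨(hN _).2 fun y => ?_, SMod.par_mem Q hm.2⟩
      rw [M.act_par_odd (L.mem_odd_of_gneg y.2)]
      exact Q.neg_mem (SMod.par_mem Q ((hN m).1 hm.1 y))
    · refine hQind _ fun ω ω' => ⟨hQ ω ω', (hN _).2 fun y => ?_, hQ ω ω'⟩
      induction ω using ExteriorAlgebra.left_induction' with
      | one =>
        have h3 := hQ 1 (ι ℂ y * ω')
        rw [M.negAct_ι_mul, map_one, Module.End.one_apply] at h3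
        rwa [map_one, Module.End.one_apply]
      | add a b ha hb =>
        simp only [map_add, LinearMap.add_apply]
        exact Q.add_mem ha hb
      | smul c a ha =>
        simp only [map_smul, LinearMap.smul_apply]
        exact (Q.restrictScalars ℂ).smul_mem c ha
      | ι_mul x a ha =>
        have h3 := M.act_bracketPN x y (M.posAct a (M.negAct ω' m₀))
        rw [← sub_eq_iff_eq_add'] at h3
        rw [M.posAct_ι_mul, ← h3]
        exact Q.sub_mem (SMod.act_mem Q _ (hQ a ω')) (hpos x _ ha)
  have hm₀Q : m₀ ∈ Q := by
    have h3 := hQ 1 1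
    rwa [map_one, map_one, Module.End.one_apply, Module.End.one_apply] at h3
  have hsub : M.IsSubmod (Q.restrictScalars ℂ) := by
    refine (M.isSubmod_iff _).2 ⟨fun x m hm => ?_, fun m hm => SMod.par_mem Q hm⟩
    obtain ⟨y, hy, h, hh, p, hp, rfl⟩ := L.exists_eq_add x
    simp only [map_add, LinearMap.add_apply]
    exact Q.add_mem (Q.add_mem (hneg ⟨y, hy⟩ m hm) (SMod.act_mem Q ⟨h, hh⟩ hm)) (hpos ⟨p, hp⟩ m hm)
  rcases hM.2 _ hsub with h | h
  · exact absurd ((Submodule.mem_bot ℂ).1 (h ▸ hm₀Q : m₀ ∈ (⊥ : Submodule ℂ M.carrier))) hm₀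
  · exact Submodule.restrictScalars_eq_top_iff ℂ M.evenAlg M.carrier |>.1 h

/-- Some element of `Λ(𝔤₁)` acts nontrivially although it kills the image of `𝔤₁`. -/
theorem SMod.exists_posAct_mul_ι_eq_zero [FiniteDimensional ℂ L.gpos] {m : M.carrier}
    (hm : m ≠ 0) : ∃ a, M.posAct a ≠ 0 ∧ ∀ x, M.posAct (a * ι ℂ x) = 0 := by
  obtain ⟨a, ha, h⟩ := exists_ne_zero_ι_mul_eq_zero
    (M.posAct.toLinearMap ∘ₗ CliffordAlgebra.reverse) (fun h1 => hm (by
      have h2 := LinearMap.congr_fun h1 m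
      rwa [LinearMap.comp_apply, CliffordAlgebra.reverse.map_one, AlgHom.toLinearMap_apply,
        map_one] at h2))
  refine ⟨CliffordAlgebra.reverse a, ha, fun x => ?_⟩
  have h2 := h x
  rwa [LinearMap.comp_apply, CliffordAlgebra.reverse.map_mul, CliffordAlgebra.reverse_ι] at h2

/-- The quotient of a supermodule by a graded `𝔤₀`-stable subspace. -/
def SMod.quotient0 (N : Submodule ℂ M.carrier) (h0 : ∀ h : L.g0, ∀ m ∈ N, M.act h m ∈ N)
    (hpar : ∀ m ∈ N, M.par m ∈ N) : SMod0 L :=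
  SMod0.ofPar (M.carrier ⧸ N) (N.mapQ N M.par hpar)
    (fun z => by
      obtain ⟨m, rfl⟩ := Submodule.Quotient.mk_surjective _ z
      exact congrArg _ (M.par_par m))
    { toFun := fun h => N.mapQ N (M.act h) (h0 h)
      map_add' := fun h h' => by
        ext m
        exact congrArg (Submodule.Quotient.mk (p := N))
          (LinearMap.congr_fun (map_add M.act h.1 h'.1) m)
      map_smul' := fun c h => by
        ext m
        exact congrArg (Submodule.Quotient.mk (p := N))
          (LinearMap.congr_fun (map_smul M.act c h.1) m) }
    (fun h z => by
      obtain ⟨m, rfl⟩ := Submodule.Quotient.mk_surjective _ z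
      exact congrArg (Submodule.Quotient.mk (p := N)) (M.act_par h.2 m).symm)
    (fun h h' z => by
      obtain ⟨m, rfl⟩ := Submodule.Quotient.mk_surjective _ z
      exact congrArg (Submodule.Quotient.mk (p := N)) (M.act_br_e h h' (Or.inl h.2) m))

theorem SMod.quotient0_par (N : Submodule ℂ M.carrier) (h0 : ∀ h : L.g0, ∀ m ∈ N, M.act h m ∈ N)
    (hpar : ∀ m ∈ N, M.par m ∈ N) (m : M.carrier) :
    (SMod.quotient0 N h0 hpar).par (N.mkQ m) = N.mkQ (M.par m) :=
  parity_evenPart_oddPart (θ := N.mapQ N M.par hpar)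
    (fun z => by
      obtain ⟨m, rfl⟩ := Submodule.Quotient.mk_surjective _ z
      exact congrArg _ (M.par_par m)) (N.mkQ m)

/-- The quotient of a supermodule by a submodule over the algebra of even operators. -/
def SMod.evenQuotient (P : Submodule M.evenAlg M.carrier) : SMod0 L :=
  SMod.quotient0 (P.restrictScalars ℂ) (fun h _ hm => SMod.act_mem P h hm)
    (fun _ hm => SMod.par_mem P hm)

/-- The quotient map. -/
def SMod.evenMk (P : Submodule M.evenAlg M.carrier) :
    M.carrier →ₗ[ℂ] (SMod.evenQuotient P).carrier := (P.restrictScalars ℂ).mkQ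

theorem SMod.evenMk_eq_zero {P : Submodule M.evenAlg M.carrier} {m : M.carrier} :
    SMod.evenMk P m = 0 ↔ m ∈ P := Submodule.Quotient.mk_eq_zero _

theorem SMod.evenMk_surjective (P : Submodule M.evenAlg M.carrier) :
    Surjective (SMod.evenMk P) := Submodule.mkQ_surjective _

theorem SMod.evenMk_act (P : Submodule M.evenAlg M.carrier) (h : L.g0) (m : M.carrier) :
    SMod.evenMk P (M.act h m) = (SMod.evenQuotient P).act h (SMod.evenMk P m) := rfl

theorem SMod.evenMk_par (P : Submodule M.evenAlg M.carrier) (m : M.carrier) :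
    SMod.evenMk P (M.par m) = (SMod.evenQuotient P).par (SMod.evenMk P m) :=
  (SMod.quotient0_par (P.restrictScalars ℂ) (fun h _ hm => SMod.act_mem P h hm)
    (fun _ hm => SMod.par_mem P hm) m).symm

theorem SMod.isSimple_evenQuotient {P : Submodule M.evenAlg M.carrier} (hP : IsCoatom P) :
    (SMod.evenQuotient P).IsSimple := by
  have hne : ∃ m, m ∉ P := by
    by_contra! h
    exact hP.1 (eq_top_iff.2 fun m _ => h m)
  obtain ⟨m, hm⟩ := hne
  refine ⟨fun h => hm (SMod.evenMk_eq_zero.1 ?_), fun N hN => ?_⟩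
  · exact (Submodule.mem_bot ℂ).1 (h ▸ Submodule.mem_top)
  · rw [SMod0.isSubmod_iff] at hN
    let N' := SMod.evenSubmodule (N.comap (SMod.evenMk P))
      (fun h m hm => by
        rw [Submodule.mem_comap, SMod.evenMk_act]
        exact hN.1 h _ hm)
      (fun m hm => by
        rw [Submodule.mem_comap, SMod.evenMk_par]
        exact hN.2 _ hm)
    have hPN : P ≤ N' := fun m hm => by
      change SMod.evenMk P m ∈ N
      rw [SMod.evenMk_eq_zero.2 hm]
      exact N.zero_mem
    rcases hP.le_iff.1 hPN with h | h
    · right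
      refine eq_top_iff.2 fun w _ => ?_
      obtain ⟨m, rfl⟩ := SMod.evenMk_surjective P w
      exact (h ▸ Submodule.mem_top : m ∈ N')
    · left
      refine eq_bot_iff.2 fun w hw => ?_
      obtain ⟨m, rfl⟩ := SMod.evenMk_surjective P w
      have : m ∈ N' := hw
      rw [h] at this
      exact (Submodule.mem_bot ℂ).2 (SMod.evenMk_eq_zero.2 this)

theorem SMod.IsSimple.exists_quotient [FiniteDimensional ℂ L.gneg] [FiniteDimensional ℂ L.gpos]
    (hM : M.IsSimple) : ∃ (W : SMod0 L) (ψ : M.carrier →ₗ[ℂ] W.carrier), W.IsSimple ∧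
      (∀ m, ψ (M.par m) = W.par (ψ m)) ∧ (∀ (h : L.g0) m, ψ (M.act h m) = W.act h (ψ m)) ∧
      (∀ x ∈ L.gpos, ∀ m, ψ (M.act x m) = 0) ∧ ψ ≠ 0 := by
  obtain ⟨m₀, -, hm₀⟩ := (Submodule.ne_bot_iff _).1 hM.1
  have := hM.finite_evenAlg
  let P₀ : Submodule ℂ M.carrier := ⨆ x : L.gpos, LinearMap.range (M.act x)
  have hmem (x : L.gpos) (m : M.carrier) : M.act x m ∈ P₀ :=
    Submodule.mem_iSup_of_mem x ⟨m, rfl⟩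
  have hle (N : Submodule ℂ M.carrier) (hN : ∀ (x : L.gpos) m, M.act x m ∈ N) : P₀ ≤ N := by
    refine iSup_le fun x => ?_
    rintro _ ⟨m, rfl⟩
    exact hN x m
  let P₁ := SMod.evenSubmodule P₀
    (fun h => hle (P₀.comap (M.act h)) fun x m => by
      have h2 := M.act_adPos h x m
      rw [eq_sub_iff_add_eq] at h2
      rw [Submodule.mem_comap, ← h2]
      exact P₀.add_mem (hmem _ _) (hmem _ _))
    (hle (P₀.comap M.par) fun x m => by
      rw [Submodule.mem_comap, ← neg_neg (M.par _), ← M.act_par_odd (L.mem_odd_of_gpos x.2)]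
      exact P₀.neg_mem (hmem _ _))
  have hP₁ : P₁ ≠ ⊤ := by
    intro h
    obtain ⟨a, ha, hx⟩ := SMod.exists_posAct_mul_ι_eq_zero hm₀
    refine ha (LinearMap.ext fun m => ?_)
    refine hle (LinearMap.ker (M.posAct a)) (fun x m => ?_) (h ▸ Submodule.mem_top : m ∈ P₁)
    rw [LinearMap.mem_ker, ← M.posAct_mul_ι, hx, LinearMap.zero_apply]
  obtain ⟨P, hP, hle'⟩ := (eq_top_or_exists_le_coatom P₁).resolve_left hP₁
  refine ⟨SMod.evenQuotient P, SMod.evenMk P, SMod.isSimple_evenQuotient hP, SMod.evenMk_par P,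
    SMod.evenMk_act P, fun x hx m => SMod.evenMk_eq_zero.2 (hle' (hmem ⟨x, hx⟩ m)), fun h => ?_⟩
  refine hP.1 (eq_top_iff.2 fun m _ => SMod.evenMk_eq_zero.1 ?_)
  rw [h, LinearMap.zero_apply]

end TopQuotient

section Socle

open ExteriorAlgebra

variable {L : GLSA}

theorem SMod.isSubmod_ker {M N : SMod L} (f : SHom M N) : M.IsSubmod (LinearMap.ker f.toLin) := by
  refine (M.isSubmod_iff _).2 ⟨fun x m hm => ?_, fun m hm => ?_⟩
  · rw [LinearMap.mem_ker, f.equivar, LinearMap.mem_ker.1 hm, map_zero]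
  · rw [LinearMap.mem_ker, f.map_par, LinearMap.mem_ker.1 hm, map_zero]

theorem SMod.isSubmod_map {M N : SMod L} (f : SHom M N) {P : Submodule ℂ M.carrier}
    (hP : M.IsSubmod P) : N.IsSubmod (P.map f.toLin) := by
  rw [SMod.isSubmod_iff] at hP ⊢
  refine ⟨?_, ?_⟩
  · rintro x _ ⟨m, hm, rfl⟩
    exact ⟨M.act x m, hP.1 x m hm, f.equivar x m⟩
  · rintro _ ⟨m, hm, rfl⟩
    exact ⟨M.par m, hP.2 m hm, f.map_par m⟩

theorem SMod.isSubmod_comap {M N : SMod L} (f : SHom M N) {P : Submodule ℂ N.carrier}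
    (hP : N.IsSubmod P) : M.IsSubmod (P.comap f.toLin) := by
  rw [SMod.isSubmod_iff] at hP ⊢
  refine ⟨fun x m hm => ?_, fun m hm => ?_⟩
  · rw [Submodule.mem_comap, f.equivar]
    exact hP.1 x _ hm
  · rw [Submodule.mem_comap, f.map_par]
    exact hP.2 _ hm

theorem SMod.isSubmod_inf {M : SMod L} {P Q : Submodule ℂ M.carrier} (hP : M.IsSubmod P)
    (hQ : M.IsSubmod Q) : M.IsSubmod (P ⊓ Q) := by
  rw [SMod.isSubmod_iff] at *
  exact ⟨fun x m hm => ⟨hP.1 x m hm.1, hQ.1 x m hm.2⟩, fun m hm => ⟨hP.2 m hm.1, hQ.2 m hm.2⟩⟩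

theorem SMod.IsSimple.injective {M N : SMod L} (hM : M.IsSimple) {f : SHom M N}
    (hf : f.toLin ≠ 0) : Injective f.toLin :=
  LinearMap.ker_eq_bot.1 ((hM.2 _ (SMod.isSubmod_ker f)).resolve_right fun h =>
    hf (LinearMap.ker_eq_top.1 h))

theorem SMod.IsSimple.isSimpleSub_range {M N : SMod L} (hM : M.IsSimple) {f : SHom M N}
    (hf : f.toLin ≠ 0) : N.IsSimpleSub (LinearMap.range f.toLin) := by
  refine ⟨?_, fun h => hf (LinearMap.range_eq_bot.1 h), fun P hP hle => ?_⟩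
  · rw [LinearMap.range_eq_map]
    refine SMod.isSubmod_map f ⟨fun _ _ _ => trivial, ?_⟩
    rw [top_inf_eq, top_inf_eq, M.grading.sup_eq_top]
  · rw [← Submodule.map_comap_eq_of_le hle]
    rcases hM.2 _ (SMod.isSubmod_comap f hP) with h | h
    · left
      rw [h, Submodule.map_bot]
    · right
      rw [h, LinearMap.range_eq_map]

variable [FiniteDimensional ℂ L.gneg]

/-- A nonzero supermodule contains nonzero `𝔤₋₁`-invariants. -/
theorem SMod.exists_mem_invNeg {K : SMod L} {N : Submodule ℂ K.carrier} (hN : K.IsSubmod N)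
    (hne : N ≠ ⊥) : ∃ z ∈ N, z ∈ K.invNeg ∧ z ≠ 0 := by
  obtain ⟨z, hz, hz0⟩ := (Submodule.ne_bot_iff _).1 hne
  obtain ⟨a, ha, h⟩ := exists_ne_zero_ι_mul_eq_zero (K.negAct.toLinearMap.flip z) (by
    rwa [LinearMap.flip_apply, AlgHom.toLinearMap_apply, K.negAct_one])
  refine ⟨K.negAct a z, ?_, fun y hy => ?_, ha⟩
  · clear ha h
    induction a using ExteriorAlgebra.left_induction' with
    | one => rwa [K.negAct_one]
    | add x y hx hy =>
      rw [map_add, LinearMap.add_apply]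
      exact N.add_mem hx hy
    | smul c x hx =>
      rw [map_smul, LinearMap.smul_apply]
      exact N.smul_mem c hx
    | ι_mul y x hx =>
      rw [K.negAct_ι_mul]
      exact hN.1 y _ hx
  · rw [← h ⟨y, hy⟩, LinearMap.flip_apply, AlgHom.toLinearMap_apply, K.negAct_ι_mul]

variable {V W : SMod0 L} {e : V.carrier ≃ₗ[ℂ] W.carrier}

theorem kacCounit_injOn_invNeg {z : KacCarrier V} (hz : ∀ y, kacNeg V y z = 0)
    (h0 : kacCounit e z = 0) : z = 0 := by
  refine kac_ext e fun ω => ?_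
  rw [map_zero, map_zero]
  induction ω using ExteriorAlgebra.right_induction' with
  | one => rw [leftAct_one_apply, h0]
  | add x y hx hy => rw [map_add, LinearMap.add_apply, map_add, hx, hy, add_zero]
  | smul c x hx => rw [map_smul, LinearMap.smul_apply, map_smul, hx, smul_zero]
  | mul_ι y x hx => rw [leftAct_mul_ι, hz, map_zero, map_zero]

theorem SMod.exists_mem_invNeg_counit {C : SMod L} {ε : C.carrier →ₗ[ℂ] W.carrier}
    (hC : IsCoindPos W C ε) (hε : ∀ z ∈ C.invNeg, ε z = 0 → z = 0) (hW : W.IsSimple)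
    {N : Submodule ℂ C.carrier} (hN : C.IsSubmod N) (hne : N ≠ ⊥) (w : W.carrier) :
    ∃ z ∈ N, z ∈ C.invNeg ∧ ε z = w := by
  have hpar := map_parity C.grading W.grading hC.map_ev hC.map_od
  have hsub : W.IsSubmod ((N ⊓ C.invNeg).map ε) := by
    rw [SMod.isSubmod_iff] at hN
    refine (W.isSubmod_iff _).2 ⟨?_, ?_⟩
    · rintro h _ ⟨z, ⟨hz, hz'⟩, rfl⟩
      refine ⟨C.act h z, ⟨hN.1 h z hz, fun y hy => ?_⟩, hC.equivar h z⟩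
      have h1 := C.act_adNeg h ⟨y, hy⟩ z
      rw [hz' _ (adNeg L h ⟨y, hy⟩).2, hz' y hy, map_zero, zero_sub, zero_eq_neg] at h1
      exact h1
    · rintro _ ⟨z, ⟨hz, hz'⟩, rfl⟩
      refine ⟨C.par z, ⟨hN.2 z hz, fun y hy => ?_⟩, hpar z⟩
      rw [C.act_par_odd (L.mem_odd_of_gneg hy), hz' y hy, map_zero, neg_zero]
  obtain ⟨z, hz, hz', hz0⟩ := SMod.exists_mem_invNeg hN hne
  rcases hW.2 _ hsub with h | h
  · refine absurd (hε z hz' ?_) hz0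
    exact (Submodule.mem_bot ℂ).1 (h ▸ ⟨z, ⟨hz, hz'⟩, rfl⟩)
  · obtain ⟨z, hz, h⟩ := (h ▸ Submodule.mem_top : w ∈ (N ⊓ C.invNeg).map ε)
    exact ⟨z, hz.1, hz.2, h⟩

theorem SMod.socle_eq_of_isSimpleSub {C : SMod L} {ε : C.carrier →ₗ[ℂ] W.carrier}
    (hC : IsCoindPos W C ε) (hε : ∀ z ∈ C.invNeg, ε z = 0 → z = 0) (hW : W.IsSimple)
    {S : Submodule ℂ C.carrier} (hS : C.IsSimpleSub S) : C.socle = S := by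
  refine le_antisymm (sSup_le fun N hN => ?_) (le_sSup hS)
  obtain ⟨w, -, hw⟩ := (Submodule.ne_bot_iff _).1 hW.1
  obtain ⟨z, hz, hz', rfl⟩ := SMod.exists_mem_invNeg_counit hC hε hW hS.1 hS.2.1 w
  obtain ⟨z₂, hz₂, hz₂', h⟩ := SMod.exists_mem_invNeg_counit hC hε hW hN.1 hN.2.1 (ε z)
  obtain rfl : z₂ = z := by
    refine sub_eq_zero.1 (hε _ (C.invNeg.sub_mem hz₂' hz') ?_)
    rw [map_sub, h, sub_self]
  have hne : N ⊓ S ≠ ⊥ := fun hb => hw (by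
    have h0 : z₂ ∈ N ⊓ S := ⟨hz₂, hz⟩
    rw [(Submodule.mem_bot ℂ).1 (hb ▸ h0 : z₂ ∈ (⊥ : Submodule ℂ C.carrier)), map_zero])
  have h1 := (hN.2.2 _ (SMod.isSubmod_inf hN.1 hS.1) inf_le_left).resolve_left hne
  exact inf_eq_left.1 h1

theorem SMod.IsSimple.exists_eq_socle [FiniteDimensional ℂ L.gpos] {M : SMod L}
    (hM : M.IsSimple) :
    ∃ (V W : SMod0 L) (K : SMod L) (η : V.carrier →ₗ[ℂ] K.carrier)
      (ε : K.carrier →ₗ[ℂ] W.carrier), V.IsSimple ∧ W.IsSimple ∧ IsKac V K η ∧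
      IsCoindPos W K ε ∧
      ∃ f : SHom M K, Injective f.toLin ∧ LinearMap.range f.toLin = K.socle := by
  obtain ⟨W, ψ, hW, hpar, h0, hp, hψ⟩ := hM.exists_quotient
  obtain ⟨V, e, he⟩ := W.exists_isUntwist
  have hC := he.isCoindPos
  obtain ⟨f, hf, -⟩ := hC.universal M ψ
    (fun m hm => (mem_even_iff W.grading).2
      ((hpar m).symm.trans (congrArg ψ (parity_of_mem_even M.grading hm))))
    (fun m hm => (mem_odd_iff W.grading).2
      ((hpar m).symm.trans ((congrArg ψ (parity_of_mem_odd M.grading hm)).trans (map_neg ψ m))))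
    h0 hp
  have hf0 : f.toLin ≠ 0 := fun h => hψ (LinearMap.ext fun m => by
    rw [← hf, h]
    exact map_zero (kacCounit e))
  exact ⟨V, W, kacModule V, kacUnit V, kacCounit e, he.isSimple hW, hW, isKac_kacModule V, hC, f,
    hM.injective hf0, (SMod.socle_eq_of_isSimpleSub hC
      (fun z hz h => kacCounit_injOn_invNeg
        (fun y => (kacModule_act_neg V y z).symm.trans (hz y y.2)) h) hW
      (hM.isSimpleSub_range hf0)).symm⟩

end Socle

section Flip

/-- The opposite `ℤ`-grading. -/
def GLSA.flip (L : GLSA) : GLSA where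
  carrier := L.carrier
  bracket := L.bracket
  gneg := L.gpos
  g0 := L.g0
  gpos := L.gneg
  oddCompl := sup_comm L.gneg L.gpos ▸ L.oddCompl
  disjNP := L.disjNP.symm
  br_00 := L.br_00
  br_0p := L.br_0n
  br_0n := L.br_0p
  br_pn x hx y hy := L.skew_oo x (L.mem_odd_of_gneg hx) y (L.mem_odd_of_gpos hy) ▸
    L.br_pn y hy x hx
  br_pp := L.br_nn
  br_nn := L.br_pp
  skew_e := L.skew_e
  skew_oo := sup_comm L.gneg L.gpos ▸ L.skew_oo
  jacobi_e := L.jacobi_e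
  jacobi_oo := sup_comm L.gneg L.gpos ▸ L.jacobi_oo

variable {L : GLSA}

theorem GLSA.odd_flip : L.flip.odd = L.odd := sup_comm L.gpos L.gneg

/-- A supermodule, for the opposite `ℤ`-grading. -/
def SMod.flip (M : SMod L) : SMod L.flip where
  carrier := M.carrier
  act := M.act
  ev := M.ev
  od := M.od
  grading := M.grading
  act_e_ev := M.act_e_ev
  act_e_od := M.act_e_od
  act_o_ev := L.odd_flip ▸ M.act_o_ev
  act_o_od := L.odd_flip ▸ M.act_o_od
  act_br_e := M.act_br_e
  act_br_oo := L.odd_flip ▸ M.act_br_oo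

/-- A supermodule for the opposite `ℤ`-grading, for the original one. -/
def SMod.unflip (M : SMod L.flip) : SMod L where
  carrier := M.carrier
  act := M.act
  ev := M.ev
  od := M.od
  grading := M.grading
  act_e_ev := M.act_e_ev
  act_e_od := M.act_e_od
  act_o_ev := L.odd_flip ▸ M.act_o_ev
  act_o_od := L.odd_flip ▸ M.act_o_od
  act_br_e := M.act_br_e
  act_br_oo := L.odd_flip ▸ M.act_br_oo

/-- A `𝔤₀`-supermodule for the opposite `ℤ`-grading, for the original one. -/
def SMod0.unflip (V : SMod0 L.flip) : SMod0 L where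
  carrier := V.carrier
  act := V.act
  ev := V.ev
  od := V.od
  grading := V.grading
  act_ev := V.act_ev
  act_od := V.act_od
  act_br := V.act_br

/-- A homomorphism from `M` to `K`, for the original `ℤ`-grading. -/
def SHom.unflip {M : SMod L} {K : SMod L.flip} (f : SHom M.flip K) : SHom M K.unflip :=
  ⟨f.toLin, f.map_ev, f.map_od, f.equivar⟩

/-- A homomorphism from `K` to `M`, for the original `ℤ`-grading. -/
def SHom.unflip' {M : SMod L} {K : SMod L.flip} (f : SHom K M.flip) : SHom K.unflip M :=
  ⟨f.toLin, f.map_ev, f.map_od, f.equivar⟩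

/-- A homomorphism from `M` to `K`, for the opposite `ℤ`-grading. -/
def SHom.flip {M : SMod L} {K : SMod L.flip} (f : SHom M K.unflip) : SHom M.flip K :=
  ⟨f.toLin, f.map_ev, f.map_od, f.equivar⟩

/-- A homomorphism from `K` to `M`, for the opposite `ℤ`-grading. -/
def SHom.flip' {M : SMod L} {K : SMod L.flip} (f : SHom K.unflip M) : SHom K M.flip :=
  ⟨f.toLin, f.map_ev, f.map_od, f.equivar⟩

theorem IsKac.unflip {V : SMod0 L.flip} {K : SMod L.flip} {η : V.carrier →ₗ[ℂ] K.carrier}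
    (h : IsKac V K η) : IsKac' V.unflip K.unflip η where
  map_ev := h.map_ev
  map_od := h.map_od
  equivar := h.equivar
  neg_zero := h.pos_zero
  injective := h.injective
  generates := h.generates
  universal M φ h1 h2 h3 h4 := by
    obtain ⟨Φ, hΦ, huniq⟩ := h.universal M.flip φ h1 h2 h3 h4
    exact ⟨Φ.unflip', hΦ, fun f hf => congrArg SHom.unflip' (huniq f.flip' hf)⟩

theorem IsCoindPos.unflip {W : SMod0 L.flip} {C : SMod L.flip} {ε : C.carrier →ₗ[ℂ] W.carrier}
    (h : IsCoindPos W C ε) : IsCoindNeg W.unflip C.unflip ε where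
  map_ev := h.map_ev
  map_od := h.map_od
  equivar := h.equivar
  neg_zero := h.pos_zero
  universal M ψ h1 h2 h3 h4 := by
    obtain ⟨Φ, hΦ, huniq⟩ := h.universal M.flip ψ h1 h2 h3 h4
    exact ⟨Φ.unflip, hΦ, fun f hf => congrArg SHom.unflip (huniq f.flip hf)⟩

end Flip
/-- For every simple `𝔤`-supermodule `M` there exist simple
`𝔤₀`-supermodules `V₁`, `V₂`, `V₃`, `V₄` such that `M` is isomorphic to the socle of
`K(V₁)`, of `K'(V₂)`, of `Coind_{𝔤≥0}^𝔤(V₃)` and of `Coind_{𝔤≤0}^𝔤(V₄)`. -/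
theorem statement_8 (L : GLSA)
    [FiniteDimensional ℂ ↥L.gneg] [FiniteDimensional ℂ ↥L.gpos]
    (M : SMod L) (hM : M.IsSimple) :
    (∃ V₁ : SMod0 L, V₁.IsSimple ∧
      ∃ (K : SMod L) (η : V₁.carrier →ₗ[ℂ] K.carrier), IsKac V₁ K η ∧
        ∃ f : SHom M K, Injective f.toLin ∧ LinearMap.range f.toLin = K.socle) ∧
    (∃ V₂ : SMod0 L, V₂.IsSimple ∧
      ∃ (K' : SMod L) (η' : V₂.carrier →ₗ[ℂ] K'.carrier), IsKac' V₂ K' η' ∧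
        ∃ f : SHom M K', Injective f.toLin ∧ LinearMap.range f.toLin = K'.socle) ∧
    (∃ V₃ : SMod0 L, V₃.IsSimple ∧
      ∃ (C : SMod L) (ε : C.carrier →ₗ[ℂ] V₃.carrier), IsCoindPos V₃ C ε ∧
        ∃ f : SHom M C, Injective f.toLin ∧ LinearMap.range f.toLin = C.socle) ∧
    (∃ V₄ : SMod0 L, V₄.IsSimple ∧
      ∃ (C' : SMod L) (ε' : C'.carrier →ₗ[ℂ] V₄.carrier), IsCoindNeg V₄ C' ε' ∧
        ∃ f : SHom M C', Injective f.toLin ∧ LinearMap.range f.toLin = C'.socle) := by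
  obtain ⟨V₁, V₃, K, η, ε, hV₁, hV₃, hK, hC, hf⟩ := hM.exists_eq_socle
  have hfn : FiniteDimensional ℂ L.flip.gneg := inferInstanceAs (FiniteDimensional ℂ L.gpos)
  have hfp : FiniteDimensional ℂ L.flip.gpos := inferInstanceAs (FiniteDimensional ℂ L.gneg)
  have hM' : M.flip.IsSimple := hM
  obtain ⟨V₂, V₄, K', η', ε', hV₂, hV₄, hK', hC', f, hf'⟩ := hM'.exists_eq_socle
  exact ⟨⟨V₁, hV₁, K, η, hK, hf⟩, ⟨V₂.unflip, hV₂, K'.unflip, η', hK'.unflip, f.unflip, hf'⟩,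
    ⟨V₃, hV₃, K, ε, hC, hf⟩, ⟨V₄.unflip, hV₄, K'.unflip, ε', hC'.unflip, f.unflip, hf'⟩⟩
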